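/- arXiv:0912.1052 — 8 statements merged into one kernel-verified Lean document; each statement's English description precedes it below -/
import Mathlib

section
/- Let K be the non-associative ℂ-algebra defined below and let J₀ ⊆ K be the ℂ-span of the elements f'(ξ)k⊗tⁿ + n f(ξ)k⊗tⁿ⁻¹ for f(ξ) ∈ ℂ((ξ)) and n ∈ ℤ. Then J₀ is a two-sided ideal of K (i.e. [K,J₀] ⊆ J₀ and [J₀,K] ⊆ J₀), and the induced bilinear product on the quotient K/J₀ is skew-symmetric and satisfies the Jacobi identity, so that K/J₀ (denoted K(g,p)) is a Lie algebra over ℂ. -/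
/-!
Statement 0 (Proposition 3.6, first part): for a Lie algebra `g` over ℂ with a
nondegenerate symmetric invariant bilinear form and `p(ξ) ∈ ℂ((ξ))`, the span `J₀`
of the elements `f'(ξ)k⊗tⁿ + n f(ξ)k⊗tⁿ⁻¹` is a two-sided ideal of the
non-associative algebra `K = ℂ((ξ))(g ⊕ g¹ ⊕ ℂk) ⊗ ℂ[t,t⁻¹]`, and the induced
product on `K/J₀` is skew-symmetric and satisfies the Jacobi identity.
-/

open scoped TensorProduct

noncomputable section

/-- The formal derivative on `ℂ((ξ))`. -/
abbrev LSderiv (f : LaurentSeries ℂ) : LaurentSeries ℂ := LaurentSeries.derivative ℂ f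

/-- The underlying ℂ-vector space of `K = ℂ((ξ))(g ⊕ g¹ ⊕ ℂk) ⊗ ℂ[t,t⁻¹]`:
an element supported at `n ∈ ℤ` with value `f ⊗ (a,b,c)` represents
`f(ξ)a ⊗ tⁿ + f(ξ)b¹ ⊗ tⁿ + c·f(ξ)k ⊗ tⁿ`. -/
abbrev KSp (g : Type) [AddCommGroup g] [Module ℂ g] : Type :=
  ℤ →₀ (LaurentSeries ℂ ⊗[ℂ] (g × g × ℂ))

variable {g : Type} [LieRing g] [LieAlgebra ℂ g]

/-- The element `f(ξ)a ⊗ tⁿ` of `K` (with `a` in the first copy of `g`). -/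
def aelt (f : LaurentSeries ℂ) (a : g) (n : ℤ) : KSp g :=
  Finsupp.single n (f ⊗ₜ[ℂ] (a, 0, 0))

/-- The element `f(ξ)a¹ ⊗ tⁿ` of `K` (with `a¹` in the second copy `g¹` of `g`). -/
def belt (f : LaurentSeries ℂ) (a : g) (n : ℤ) : KSp g :=
  Finsupp.single n (f ⊗ₜ[ℂ] (0, a, 0))

/-- The central element `f(ξ)k ⊗ tⁿ` of `K`. -/
def kelt (g : Type) [LieRing g] [LieAlgebra ℂ g] (f : LaurentSeries ℂ) (n : ℤ) : KSp g :=
  Finsupp.single n (f ⊗ₜ[ℂ] ((0 : g), (0 : g), (1 : ℂ)))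

/-- `J₀`: the ℂ-span of the elements `f'(ξ)k⊗tⁿ + n f(ξ)k⊗tⁿ⁻¹`. -/
def J0 (g : Type) [LieRing g] [LieAlgebra ℂ g] : Submodule ℂ (KSp g) :=
  Submodule.span ℂ {x | ∃ (f : LaurentSeries ℂ) (n : ℤ),
    x = kelt g (LSderiv f) n + (n : ℂ) • kelt g f (n - 1)}

set_option linter.unusedSimpArgs false

theorem LS_theta_coeff (f : LaurentSeries ℂ) (n : ℤ) :
    (HahnSeries.single (1 : ℤ) (1 : ℂ) * LSderiv f).coeff n = (n : ℂ) * f.coeff n := by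
  rw [HahnSeries.coeff_single_mul, LSderiv, LaurentSeries.derivative_apply,
    LaurentSeries.hasseDeriv_coeff]
  simp

theorem LS_leibniz (f h : LaurentSeries ℂ) :
    LSderiv (f * h) = LSderiv f * h + f * LSderiv h := by
  have hX : (HahnSeries.single (1 : ℤ) (1 : ℂ) : LaurentSeries ℂ) ≠ 0 := by simp
  apply mul_left_cancel₀ hX
  have key : ∀ u : LaurentSeries ℂ,
      (HahnSeries.single (1 : ℤ) (1 : ℂ) * LSderiv u).support ⊆ u.support := by
    intro u n hn
    rw [HahnSeries.mem_support, LS_theta_coeff] at hn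
    exact (HahnSeries.mem_support _ _).2 (right_ne_zero_of_mul hn)
  have e : (HahnSeries.single (1 : ℤ) (1 : ℂ) : LaurentSeries ℂ)
      * (LSderiv f * h + f * LSderiv h)
      = (HahnSeries.single (1 : ℤ) (1 : ℂ) * LSderiv f) * h
        + f * (HahnSeries.single (1 : ℤ) (1 : ℂ) * LSderiv h) := by ring
  rw [e]
  ext n
  rw [LS_theta_coeff, HahnSeries.coeff_add, HahnSeries.coeff_mul,
    HahnSeries.coeff_mul_left' f.isPWO_support (key f),
    HahnSeries.coeff_mul_right' h.isPWO_support (key h), Finset.mul_sum,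
    ← Finset.sum_add_distrib]
  refine Finset.sum_congr rfl fun ij hij => ?_
  rw [LS_theta_coeff, LS_theta_coeff]
  have : ij.1 + ij.2 = n := (Finset.mem_antidiagonal.1 hij).2.2
  rw [← this]
  push_cast
  ring

theorem KSp_induction {P : KSp g → Prop} (h0 : P 0) (hadd : ∀ x y, P x → P y → P (x + y))
    (ha : ∀ f a n, P (aelt f a n)) (hb : ∀ f a n, P (belt f a n))
    (hk : ∀ f n, P (kelt g f n)) (x : KSp g) : P x := by
  induction x using Finsupp.induction_linear with
  | zero => exact h0
  | add x y hx hy => exact hadd x y hx hy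
  | single n t =>
    induction t using TensorProduct.induction_on with
    | zero => simpa using h0
    | add s t hs ht => rw [Finsupp.single_add]; exact hadd _ _ hs ht
    | tmul f v =>
      obtain ⟨a, b, c⟩ := v
      have : (Finsupp.single n (f ⊗ₜ[ℂ] (a, b, c)) : KSp g)
          = aelt f a n + belt f b n + kelt g (c • f) n := by
        unfold aelt belt kelt
        rw [← Finsupp.single_add, ← Finsupp.single_add, TensorProduct.smul_tmul,
          ← TensorProduct.tmul_add, ← TensorProduct.tmul_add]
        simp
      rw [this]
      exact hadd _ _ (hadd _ _ (ha _ _ _) (hb _ _ _)) (hk _ _)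

theorem kelt_add (f h : LaurentSeries ℂ) (n : ℤ) :
    kelt g (f + h) n = kelt g f n + kelt g h n := by
  simp [kelt, TensorProduct.add_tmul]

theorem aelt_add (f : LaurentSeries ℂ) (a b : g) (n : ℤ) :
    aelt f (a + b) n = aelt f a n + aelt f b n := by
  unfold aelt
  rw [← Finsupp.single_add, ← TensorProduct.tmul_add]
  simp

theorem belt_add (f : LaurentSeries ℂ) (a b : g) (n : ℤ) :
    belt f (a + b) n = belt f a n + belt f b n := by
  unfold belt
  rw [← Finsupp.single_add, ← TensorProduct.tmul_add]
  simp

set_option maxSynthPendingDepth 3 in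
theorem aelt_neg (f : LaurentSeries ℂ) (a : g) (n : ℤ) :
    aelt f (-a) n = - aelt f a n := by
  rw [eq_neg_iff_add_eq_zero, ← aelt_add]; simp only [aelt, add_neg_cancel, neg_add_cancel]
  exact (congrArg _ (TensorProduct.tmul_zero _ _)).trans (Finsupp.single_zero _)

set_option maxSynthPendingDepth 3 in
theorem belt_neg (f : LaurentSeries ℂ) (a : g) (n : ℤ) :
    belt f (-a) n = - belt f a n := by
  rw [eq_neg_iff_add_eq_zero, ← belt_add]; simp only [belt, add_neg_cancel, neg_add_cancel]
  exact (congrArg _ (TensorProduct.tmul_zero _ _)).trans (Finsupp.single_zero _)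

theorem J0_gen (f : LaurentSeries ℂ) (n : ℤ) (c : ℂ) :
    c • (kelt g (LSderiv f) n + (n : ℂ) • kelt g f (n - 1)) ∈ J0 g :=
  Submodule.smul_mem _ _ (Submodule.subset_span ⟨f, n, rfl⟩)

set_option maxSynthPendingDepth 3 in
theorem statement0
    (Φ : g →ₗ[ℂ] g →ₗ[ℂ] ℂ)
    (hsymm : ∀ a b : g, Φ a b = Φ b a)
    (hinv : ∀ a b c : g, Φ ⁅a, b⁆ c = Φ a ⁅b, c⁆)
    (hnondeg : ∀ a : g, (∀ b : g, Φ a b = 0) → a = 0)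
    (p : LaurentSeries ℂ)
    -- the ℂ-bilinear product of `K`, specified on spanning elements:
    (B : KSp g →ₗ[ℂ] KSp g →ₗ[ℂ] KSp g)
    (hkl : ∀ (f : LaurentSeries ℂ) (m : ℤ) (x : KSp g), B (kelt g f m) x = 0)
    (hkr : ∀ (f : LaurentSeries ℂ) (m : ℤ) (x : KSp g), B x (kelt g f m) = 0)
    (haa : ∀ (f h : LaurentSeries ℂ) (a b : g) (m n : ℤ),
      B (aelt f a m) (aelt h b n)
        = aelt (f * h) ⁅a, b⁆ (m + n)
          + Φ a b • kelt g (LSderiv f * h) (m + n)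
          + ((m : ℂ) * Φ a b) • kelt g (f * h) (m + n - 1))
    (hab : ∀ (f h : LaurentSeries ℂ) (a b : g) (m n : ℤ),
      B (aelt f a m) (belt h b n) = belt (f * h) ⁅a, b⁆ (m + n))
    (hba : ∀ (f h : LaurentSeries ℂ) (a b : g) (m n : ℤ),
      B (belt f a m) (aelt h b n) = belt (f * h) ⁅a, b⁆ (m + n))
    (hbb : ∀ (f h : LaurentSeries ℂ) (a b : g) (m n : ℤ),
      B (belt f a m) (belt h b n)
        = aelt (f * h * p) ⁅a, b⁆ (m + n)
          + Φ a b • kelt g (LSderiv f * h * p) (m + n)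
          + ((1 / 2 : ℂ) * Φ a b) • kelt g (f * h * LSderiv p) (m + n)
          + ((m : ℂ) * Φ a b) • kelt g (f * h * p) (m + n - 1)) :
    -- `J₀` is a two-sided ideal of `K`:
    (∀ x ∈ J0 g, ∀ y : KSp g, B x y ∈ J0 g ∧ B y x ∈ J0 g) ∧
    -- the induced product on `K/J₀` is skew-symmetric:
    (∀ x y : KSp g, B x y + B y x ∈ J0 g) ∧
    -- and satisfies the Jacobi identity, i.e. `K/J₀ = K(g,p)` is a Lie algebra over ℂ:
    (∀ x y z : KSp g, B x (B y z) - B (B x y) z - B y (B x z) ∈ J0 g) := by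
  have hJl : ∀ x ∈ J0 g, ∀ y, B x y = 0 := by
    intro x hx y
    induction hx using Submodule.span_induction with
    | mem x hx => obtain ⟨f, n, rfl⟩ := hx; simp [hkl]
    | zero => simp
    | add x y _ _ h1 h2 => simp [h1, h2]
    | smul c x _ h => simp [h]
  have hJr : ∀ x ∈ J0 g, ∀ y, B y x = 0 := by
    intro x hx y
    induction hx using Submodule.span_induction with
    | mem x hx => obtain ⟨f, n, rfl⟩ := hx; simp [hkr]
    | zero => simp
    | add x y _ _ h1 h2 => simp [h1, h2]
    | smul c x _ h => simp [h]
  refine ⟨fun x hx y => ?_, fun x y => ?_, fun x y z => ?_⟩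
  · rw [hJl x hx, hJr x hx]; exact ⟨zero_mem _, zero_mem _⟩
  · induction x using KSp_induction with
    | h0 => simp
    | hadd x x' h h' =>
      have e : B (x + x') y + B y (x + x') = (B x y + B y x) + (B x' y + B y x') := by
        simp only [map_add, LinearMap.add_apply]; abel
      rw [e]; exact add_mem h h'
    | hk f n => simp [hkl, hkr]
    | ha f a m =>
      induction y using KSp_induction with
      | h0 => simp
      | hadd x x' h h' =>
        have e : B (aelt f a m) (x + x') + B (x + x') (aelt f a m)
          = (B (aelt f a m) x + B x (aelt f a m)) + (B (aelt f a m) x' + B x' (aelt f a m)) := by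
          simp only [map_add, LinearMap.add_apply]; abel
        rw [e]; exact add_mem h h'
      | hk f n => simp [hkl, hkr]
      | ha h b n =>
        convert J0_gen (g := g) (f * h) (m + n) (Φ a b) using 1
        rw [haa, haa, LS_leibniz, kelt_add, ← lie_skew a b, aelt_neg, hsymm b a,
          mul_comm h f, mul_comm (LSderiv h) f, add_comm n m]
        push_cast
        module
      | hb h b n =>
        rw [hab, hba, ← lie_skew a b, belt_neg, mul_comm h f, add_comm n m]
        simp
    | hb f a m =>
      induction y using KSp_induction with
      | h0 => simp
      | hadd x x' h h' =>
        have e : B (belt f a m) (x + x') + B (x + x') (belt f a m)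
          = (B (belt f a m) x + B x (belt f a m)) + (B (belt f a m) x' + B x' (belt f a m)) := by
          simp only [map_add, LinearMap.add_apply]; abel
        rw [e]; exact add_mem h h'
      | hk f n => simp [hkl, hkr]
      | ha h b n =>
        rw [hab, hba, ← lie_skew a b, belt_neg, mul_comm h f, add_comm n m]
        simp
      | hb h b n =>
        convert J0_gen (g := g) (f * h * p) (m + n) (Φ a b) using 1
        rw [hbb, hbb, LS_leibniz, LS_leibniz, add_mul, kelt_add, kelt_add, ← lie_skew a b,
          aelt_neg, hsymm b a, mul_comm h f, mul_comm (LSderiv h) f, add_comm n m]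
        push_cast
        module
  · have key : B x (B y z) - B (B x y) z - B y (B x z) = 0 := by
      induction x using KSp_induction with
      | h0 => simp
      | hadd u u' h h' =>
        refine Eq.trans ?_ ((congrArg₂ (· + ·) h h').trans (add_zero 0))
        simp only [map_add, LinearMap.add_apply]
        abel
      | hk f n => simp [hkl, hkr]
      | ha f a m =>
        induction y using KSp_induction with
        | h0 => simp
        | hadd u u' h h' =>
          refine Eq.trans ?_ ((congrArg₂ (· + ·) h h').trans (add_zero 0))
          simp only [map_add, LinearMap.add_apply]
          abel
        | hk f n => simp [hkl, hkr]
        | ha h b n =>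
          induction z using KSp_induction with
          | h0 => simp
          | hadd u u' h h' =>
            refine Eq.trans ?_ ((congrArg₂ (· + ·) h h').trans (add_zero 0))
            simp only [map_add, LinearMap.add_apply]
            abel
          | hk f n => simp [hkl, hkr]
          | ha q c l =>
            have h1 : Φ b ⁅a, c⁆ = - Φ ⁅a, b⁆ c := by
              rw [← hinv, ← lie_skew, map_neg, LinearMap.neg_apply]
            simp only [haa, hab, hba, hbb, hkl, hkr, map_add, map_smul, LinearMap.add_apply,
              LinearMap.smul_apply, smul_zero, add_zero, LS_leibniz, kelt_add, add_mul, h1,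
              leibniz_lie a b c, aelt_add, belt_add, ← hinv a b c]
            ring_nf
            module
          | hb q c l =>
            have h1 : Φ b ⁅a, c⁆ = - Φ ⁅a, b⁆ c := by
              rw [← hinv, ← lie_skew, map_neg, LinearMap.neg_apply]
            simp only [haa, hab, hba, hbb, hkl, hkr, map_add, map_smul, LinearMap.add_apply,
              LinearMap.smul_apply, smul_zero, add_zero, LS_leibniz, kelt_add, add_mul, h1,
              leibniz_lie a b c, aelt_add, belt_add, ← hinv a b c]
            ring_nf
            module
        | hb h b n =>
          induction z using KSp_induction with
          | h0 => simp
          | hadd u u' h h' =>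
            refine Eq.trans ?_ ((congrArg₂ (· + ·) h h').trans (add_zero 0))
            simp only [map_add, LinearMap.add_apply]
            abel
          | hk f n => simp [hkl, hkr]
          | ha q c l =>
            have h1 : Φ b ⁅a, c⁆ = - Φ ⁅a, b⁆ c := by
              rw [← hinv, ← lie_skew, map_neg, LinearMap.neg_apply]
            simp only [haa, hab, hba, hbb, hkl, hkr, map_add, map_smul, LinearMap.add_apply,
              LinearMap.smul_apply, smul_zero, add_zero, LS_leibniz, kelt_add, add_mul, h1,
              leibniz_lie a b c, aelt_add, belt_add, ← hinv a b c]
            ring_nf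
            module
          | hb q c l =>
            have h1 : Φ b ⁅a, c⁆ = - Φ ⁅a, b⁆ c := by
              rw [← hinv, ← lie_skew, map_neg, LinearMap.neg_apply]
            simp only [haa, hab, hba, hbb, hkl, hkr, map_add, map_smul, LinearMap.add_apply,
              LinearMap.smul_apply, smul_zero, add_zero, LS_leibniz, kelt_add, add_mul, h1,
              leibniz_lie a b c, aelt_add, belt_add, ← hinv a b c]
            ring_nf
            module
      | hb f a m =>
        induction y using KSp_induction with
        | h0 => simp
        | hadd u u' h h' =>
          refine Eq.trans ?_ ((congrArg₂ (· + ·) h h').trans (add_zero 0))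
          simp only [map_add, LinearMap.add_apply]
          abel
        | hk f n => simp [hkl, hkr]
        | ha h b n =>
          induction z using KSp_induction with
          | h0 => simp
          | hadd u u' h h' =>
            refine Eq.trans ?_ ((congrArg₂ (· + ·) h h').trans (add_zero 0))
            simp only [map_add, LinearMap.add_apply]
            abel
          | hk f n => simp [hkl, hkr]
          | ha q c l =>
            have h1 : Φ b ⁅a, c⁆ = - Φ ⁅a, b⁆ c := by
              rw [← hinv, ← lie_skew, map_neg, LinearMap.neg_apply]
            simp only [haa, hab, hba, hbb, hkl, hkr, map_add, map_smul, LinearMap.add_apply,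
              LinearMap.smul_apply, smul_zero, add_zero, LS_leibniz, kelt_add, add_mul, h1,
              leibniz_lie a b c, aelt_add, belt_add, ← hinv a b c]
            ring_nf
            module
          | hb q c l =>
            have h1 : Φ b ⁅a, c⁆ = - Φ ⁅a, b⁆ c := by
              rw [← hinv, ← lie_skew, map_neg, LinearMap.neg_apply]
            simp only [haa, hab, hba, hbb, hkl, hkr, map_add, map_smul, LinearMap.add_apply,
              LinearMap.smul_apply, smul_zero, add_zero, LS_leibniz, kelt_add, add_mul, h1,
              leibniz_lie a b c, aelt_add, belt_add, ← hinv a b c]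
            ring_nf
            module
        | hb h b n =>
          induction z using KSp_induction with
          | h0 => simp
          | hadd u u' h h' =>
            refine Eq.trans ?_ ((congrArg₂ (· + ·) h h').trans (add_zero 0))
            simp only [map_add, LinearMap.add_apply]
            abel
          | hk f n => simp [hkl, hkr]
          | ha q c l =>
            have h1 : Φ b ⁅a, c⁆ = - Φ ⁅a, b⁆ c := by
              rw [← hinv, ← lie_skew, map_neg, LinearMap.neg_apply]
            simp only [haa, hab, hba, hbb, hkl, hkr, map_add, map_smul, LinearMap.add_apply,
              LinearMap.smul_apply, smul_zero, add_zero, LS_leibniz, kelt_add, add_mul, h1,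
              leibniz_lie a b c, aelt_add, belt_add, ← hinv a b c]
            ring_nf
            module
          | hb q c l =>
            have h1 : Φ b ⁅a, c⁆ = - Φ ⁅a, b⁆ c := by
              rw [← hinv, ← lie_skew, map_neg, LinearMap.neg_apply]
            simp only [haa, hab, hba, hbb, hkl, hkr, map_add, map_smul, LinearMap.add_apply,
              LinearMap.smul_apply, smul_zero, add_zero, LS_leibniz, kelt_add, add_mul, h1,
              leibniz_lie a b c, aelt_add, belt_add, ← hinv a b c]
            ring_nf
            module
    rw [key]; exact zero_mem _

end
end

section
/- Let K be the non-associative ℂ-algebra defined below and J₀ the ℂ-span of the elements f'(ξ)k⊗tⁿ + n f(ξ)k⊗tⁿ⁻¹ (f ∈ ℂ((ξ)), n ∈ ℤ). The ℂ-linear operator D̃ on K defined by D̃(u⊗tⁿ) = −n(u⊗tⁿ⁻¹) for u ∈ ℂ((ξ))(g + g¹ + ℂk) and n ∈ ℤ satisfies D̃[x,y] = [D̃x,y] + [x,D̃y] for all x,y ∈ K, and D̃(J₀) ⊆ J₀; consequently D̃ induces a derivation D of the quotient Lie algebra K(g,p) = K/J₀. -/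
/-!
Statement 1 (Proposition 3.6, last part): the ℂ-linear operator `D̃` on `K` given by
`D̃(u⊗tⁿ) = −n(u⊗tⁿ⁻¹)` is a derivation of the (non-associative) algebra `K`, and it
preserves the ideal `J₀`; consequently it induces a derivation `D` of `K(g,p) = K/J₀`.
-/

open scoped TensorProduct

noncomputable section

variable {g : Type} [LieRing g] [LieAlgebra ℂ g]

theorem KSp_ind (P : KSp g → Prop) (h0 : P 0) (hadd : ∀ x y, P x → P y → P (x + y))
    (ha : ∀ f a n, P (aelt f a n)) (hb : ∀ f a n, P (belt f a n))
    (hk : ∀ f n, P (kelt g f n)) (x : KSp g) : P x := by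
  induction x using Finsupp.induction_linear with
  | zero => exact h0
  | add x y hx hy => exact hadd x y hx hy
  | single n u =>
    induction u using TensorProduct.induction_on with
    | zero => simpa using h0
    | add u v hu hv => rw [Finsupp.single_add]; exact hadd _ _ hu hv
    | tmul f w =>
      obtain ⟨a, b, c⟩ := w
      have e : (Finsupp.single n (f ⊗ₜ[ℂ] (a, b, c)) : KSp g)
          = aelt f a n + belt f b n + kelt g (c • f) n := by
        unfold aelt belt kelt
        rw [← Finsupp.single_add, ← Finsupp.single_add, TensorProduct.smul_tmul,
          ← TensorProduct.tmul_add, ← TensorProduct.tmul_add]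
        simp
      rw [e]
      exact hadd _ _ (hadd _ _ (ha _ _ _) (hb _ _ _)) (hk _ _)

theorem statement1
    (Φ : g →ₗ[ℂ] g →ₗ[ℂ] ℂ)
    (hsymm : ∀ a b : g, Φ a b = Φ b a)
    (hinv : ∀ a b c : g, Φ ⁅a, b⁆ c = Φ a ⁅b, c⁆)
    (hnondeg : ∀ a : g, (∀ b : g, Φ a b = 0) → a = 0)
    (p : LaurentSeries ℂ)
    -- the ℂ-bilinear product of `K`, specified on spanning elements:
    (B : KSp g →ₗ[ℂ] KSp g →ₗ[ℂ] KSp g)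
    (hkl : ∀ (f : LaurentSeries ℂ) (m : ℤ) (x : KSp g), B (kelt g f m) x = 0)
    (hkr : ∀ (f : LaurentSeries ℂ) (m : ℤ) (x : KSp g), B x (kelt g f m) = 0)
    (haa : ∀ (f h : LaurentSeries ℂ) (a b : g) (m n : ℤ),
      B (aelt f a m) (aelt h b n)
        = aelt (f * h) ⁅a, b⁆ (m + n)
          + Φ a b • kelt g (LSderiv f * h) (m + n)
          + ((m : ℂ) * Φ a b) • kelt g (f * h) (m + n - 1))
    (hab : ∀ (f h : LaurentSeries ℂ) (a b : g) (m n : ℤ),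
      B (aelt f a m) (belt h b n) = belt (f * h) ⁅a, b⁆ (m + n))
    (hba : ∀ (f h : LaurentSeries ℂ) (a b : g) (m n : ℤ),
      B (belt f a m) (aelt h b n) = belt (f * h) ⁅a, b⁆ (m + n))
    (hbb : ∀ (f h : LaurentSeries ℂ) (a b : g) (m n : ℤ),
      B (belt f a m) (belt h b n)
        = aelt (f * h * p) ⁅a, b⁆ (m + n)
          + Φ a b • kelt g (LSderiv f * h * p) (m + n)
          + ((1 / 2 : ℂ) * Φ a b) • kelt g (f * h * LSderiv p) (m + n)
          + ((m : ℂ) * Φ a b) • kelt g (f * h * p) (m + n - 1))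
    -- the ℂ-linear operator `D̃(u⊗tⁿ) = −n(u⊗tⁿ⁻¹)`:
    (Dt : KSp g →ₗ[ℂ] KSp g)
    (hDt : ∀ (n : ℤ) (u : LaurentSeries ℂ ⊗[ℂ] (g × g × ℂ)),
      Dt (Finsupp.single n u) = (-n : ℂ) • Finsupp.single (n - 1) u) :
    -- `D̃` is a derivation of `K`:
    (∀ x y : KSp g, Dt (B x y) = B (Dt x) y + B x (Dt y)) ∧
    -- and `D̃` preserves `J₀`, hence induces a derivation `D` of `K(g,p) = K/J₀`:
    (∀ x ∈ J0 g, Dt x ∈ J0 g) := by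
  have dA : ∀ (f : LaurentSeries ℂ) (a : g) (n : ℤ),
      Dt (aelt f a n) = (-n : ℂ) • aelt f a (n - 1) := fun f a n => hDt _ _
  have dB : ∀ (f : LaurentSeries ℂ) (a : g) (n : ℤ),
      Dt (belt f a n) = (-n : ℂ) • belt f a (n - 1) := fun f a n => hDt _ _
  have dK : ∀ (f : LaurentSeries ℂ) (n : ℤ),
      Dt (kelt g f n) = (-n : ℂ) • kelt g f (n - 1) := fun f n => hDt _ _
  have e1 : ∀ m n : ℤ, m - 1 + n = m + n - 1 := fun m n => by ring
  have e2 : ∀ m n : ℤ, m + (n - 1) = m + n - 1 := fun m n => by ring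
  constructor
  · intro x y
    induction x using KSp_ind with
    | h0 => simp
    | hadd x x' hx hx' =>
      simp only [map_add, LinearMap.add_apply, hx, hx']; abel
    | hk f n => simp [hkl, dK]
    | ha f a m =>
      induction y using KSp_ind with
      | h0 => simp
      | hadd x x' hx hx' =>
        simp only [map_add, hx, hx']; abel
      | hk f n => simp [hkr, dK]
      | ha h b n =>
        simp only [dA, dK, haa, map_add, map_smul, LinearMap.smul_apply, e1, e2]
        push_cast
        module
      | hb h b n =>
        simp only [dA, dB, hab, map_smul, LinearMap.smul_apply, e1, e2]
        push_cast
        module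
    | hb f a m =>
      induction y using KSp_ind with
      | h0 => simp
      | hadd x x' hx hx' =>
        simp only [map_add, hx, hx']; abel
      | hk f n => simp [hkr, dK]
      | ha h b n =>
        simp only [dA, dB, hba, map_smul, LinearMap.smul_apply, e1, e2]
        push_cast
        module
      | hb h b n =>
        simp only [dA, dB, dK, hbb, map_add, map_smul, LinearMap.smul_apply, e1, e2]
        push_cast
        module
  · intro x hx
    induction hx using Submodule.span_induction with
    | zero => simp
    | add x y _ _ hx hy => rw [map_add]; exact add_mem hx hy
    | smul c x _ hx => rw [map_smul]; exact Submodule.smul_mem _ _ hx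
    | mem x hx =>
      obtain ⟨f, n, rfl⟩ := hx
      have : Dt (kelt g (LSderiv f) n + (n : ℂ) • kelt g f (n - 1))
          = (-n : ℂ) • (kelt g (LSderiv f) (n - 1)
            + ((n - 1 : ℤ) : ℂ) • kelt g f (n - 1 - 1)) := by
        simp only [map_add, map_smul, dK]
        push_cast
        module
      rw [this]
      exact Submodule.smul_mem _ _ (Submodule.subset_span ⟨f, n - 1, rfl⟩)

end
end

section
/- Suppose p(ξ) ∈ ℂ[ξ] is a polynomial. Then the image K⁰(g,p) in K(g,p) = K/J₀ of the subspace (ℂ[ξ](g ⊕ g¹) ⊗ ℂ[t,t⁻¹]) + (ℂ((ξ))k ⊗ ℂ[t,t⁻¹]) of K is a Lie subalgebra of K(g,p), and it is stable under the derivation D of K(g,p) induced by the operator D̃(u⊗tⁿ) = −n(u⊗tⁿ⁻¹). -/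
/-!
Statement 2: when `p(ξ) ∈ ℂ[ξ]` is a polynomial, the image in `K(g,p) = K/J₀` of the
subspace `K⁰ = (ℂ[ξ](g ⊕ g¹) ⊗ ℂ[t,t⁻¹]) + (ℂ((ξ))k ⊗ ℂ[t,t⁻¹])` of `K` is a Lie
subalgebra which is stable under the derivation `D` induced by `D̃(u⊗tⁿ) = −n(u⊗tⁿ⁻¹)`.
(Closure and stability in the quotient are expressed modulo `J₀`, i.e. in `K⁰ ⊔ J₀`.)
-/

open scoped TensorProduct

noncomputable section

/-- The embedding of the polynomial ring `ℂ[ξ]` into `ℂ((ξ))` (evaluation at `ξ`). -/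
def polyToL (P : Polynomial ℂ) : LaurentSeries ℂ :=
  Polynomial.aeval (HahnSeries.single (1 : ℤ) (1 : ℂ)) P

variable {g : Type} [LieRing g] [LieAlgebra ℂ g]

/-- The subspace `K⁰ = (ℂ[ξ](g ⊕ g¹) ⊗ ℂ[t,t⁻¹]) + (ℂ((ξ))k ⊗ ℂ[t,t⁻¹])` of `K`. -/
def K0 (g : Type) [LieRing g] [LieAlgebra ℂ g] : Submodule ℂ (KSp g) :=
  Submodule.span ℂ
    ({x | ∃ (Q : Polynomial ℂ) (a : g) (n : ℤ), x = aelt (polyToL Q) a n}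
      ∪ {x | ∃ (Q : Polynomial ℂ) (a : g) (n : ℤ), x = belt (polyToL Q) a n}
      ∪ {x | ∃ (f : LaurentSeries ℂ) (n : ℤ), x = kelt g f n})

theorem statement2
    (Φ : g →ₗ[ℂ] g →ₗ[ℂ] ℂ)
    (hsymm : ∀ a b : g, Φ a b = Φ b a)
    (hinv : ∀ a b c : g, Φ ⁅a, b⁆ c = Φ a ⁅b, c⁆)
    (hnondeg : ∀ a : g, (∀ b : g, Φ a b = 0) → a = 0)
    -- `p` is a polynomial:
    (P : Polynomial ℂ) (p : LaurentSeries ℂ) (hp : p = polyToL P)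
    -- the ℂ-bilinear product of `K`, specified on spanning elements:
    (B : KSp g →ₗ[ℂ] KSp g →ₗ[ℂ] KSp g)
    (hkl : ∀ (f : LaurentSeries ℂ) (m : ℤ) (x : KSp g), B (kelt g f m) x = 0)
    (hkr : ∀ (f : LaurentSeries ℂ) (m : ℤ) (x : KSp g), B x (kelt g f m) = 0)
    (haa : ∀ (f h : LaurentSeries ℂ) (a b : g) (m n : ℤ),
      B (aelt f a m) (aelt h b n)
        = aelt (f * h) ⁅a, b⁆ (m + n)
          + Φ a b • kelt g (LSderiv f * h) (m + n)
          + ((m : ℂ) * Φ a b) • kelt g (f * h) (m + n - 1))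
    (hab : ∀ (f h : LaurentSeries ℂ) (a b : g) (m n : ℤ),
      B (aelt f a m) (belt h b n) = belt (f * h) ⁅a, b⁆ (m + n))
    (hba : ∀ (f h : LaurentSeries ℂ) (a b : g) (m n : ℤ),
      B (belt f a m) (aelt h b n) = belt (f * h) ⁅a, b⁆ (m + n))
    (hbb : ∀ (f h : LaurentSeries ℂ) (a b : g) (m n : ℤ),
      B (belt f a m) (belt h b n)
        = aelt (f * h * p) ⁅a, b⁆ (m + n)
          + Φ a b • kelt g (LSderiv f * h * p) (m + n)
          + ((1 / 2 : ℂ) * Φ a b) • kelt g (f * h * LSderiv p) (m + n)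
          + ((m : ℂ) * Φ a b) • kelt g (f * h * p) (m + n - 1))
    -- the ℂ-linear operator `D̃(u⊗tⁿ) = −n(u⊗tⁿ⁻¹)` inducing the derivation `D`:
    (Dt : KSp g →ₗ[ℂ] KSp g)
    (hDt : ∀ (n : ℤ) (u : LaurentSeries ℂ ⊗[ℂ] (g × g × ℂ)),
      Dt (Finsupp.single n u) = (-n : ℂ) • Finsupp.single (n - 1) u) :
    -- the image of `K⁰` in `K/J₀` is closed under the induced bracket:
    (∀ x ∈ K0 g, ∀ y ∈ K0 g, B x y ∈ K0 g ⊔ J0 g) ∧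
    -- and is stable under the induced derivation `D`:
    (∀ x ∈ K0 g, Dt x ∈ K0 g ⊔ J0 g) := by
  have hmul : ∀ Q R : Polynomial ℂ, polyToL Q * polyToL R = polyToL (Q * R) := by
    intro Q R
    simp [polyToL]
  have hA : ∀ (Q : Polynomial ℂ) (a : g) (n : ℤ), aelt (polyToL Q) a n ∈ K0 g := fun Q a n =>
    Submodule.subset_span (Or.inl (Or.inl ⟨Q, a, n, rfl⟩))
  have hB : ∀ (Q : Polynomial ℂ) (a : g) (n : ℤ), belt (polyToL Q) a n ∈ K0 g := fun Q a n =>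
    Submodule.subset_span (Or.inl (Or.inr ⟨Q, a, n, rfl⟩))
  have hK : ∀ (f : LaurentSeries ℂ) (n : ℤ), kelt g f n ∈ K0 g := fun f n =>
    Submodule.subset_span (Or.inr ⟨f, n, rfl⟩)
  subst hp
  constructor
  · intro x hx y hy
    apply Submodule.mem_sup_left
    unfold K0 at hx hy
    induction hx, hy using Submodule.span_induction₂ with
    | mem_mem x y hx1 hy1 =>
      rcases hx1 with (⟨Q, a, m, rfl⟩ | ⟨Q, a, m, rfl⟩) | ⟨f, m, rfl⟩
      · rcases hy1 with (⟨R, b, n, rfl⟩ | ⟨R, b, n, rfl⟩) | ⟨h, n, rfl⟩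
        · rw [haa, hmul]
          exact add_mem (add_mem (hA _ _ _) (Submodule.smul_mem _ _ (hK _ _)))
            (Submodule.smul_mem _ _ (hK _ _))
        · rw [hab, hmul]
          exact hB _ _ _
        · rw [hkr]
          exact zero_mem _
      · rcases hy1 with (⟨R, b, n, rfl⟩ | ⟨R, b, n, rfl⟩) | ⟨h, n, rfl⟩
        · rw [hba, hmul]
          exact hB _ _ _
        · rw [hbb, hmul, hmul]
          exact add_mem (add_mem (add_mem (hA _ _ _) (Submodule.smul_mem _ _ (hK _ _)))
            (Submodule.smul_mem _ _ (hK _ _))) (Submodule.smul_mem _ _ (hK _ _))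
        · rw [hkr]
          exact zero_mem _
      · rw [hkl]
        exact zero_mem _
    | zero_left y hy => simp
    | zero_right x hx => simp
    | add_left x y z hx hy hz h1 h2 =>
      rw [map_add, LinearMap.add_apply]
      exact add_mem h1 h2
    | add_right x y z hx hy hz h1 h2 =>
      rw [map_add]
      exact add_mem h1 h2
    | smul_left r x y hx hy h =>
      rw [map_smul, LinearMap.smul_apply]
      exact Submodule.smul_mem _ _ h
    | smul_right r x y hx hy h =>
      rw [map_smul]
      exact Submodule.smul_mem _ _ h
  · intro x hx
    apply Submodule.mem_sup_left
    have hle : K0 g ≤ (K0 g).comap Dt := by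
      conv_lhs => unfold K0
      rw [Submodule.span_le]
      rintro x ((⟨Q, a, m, rfl⟩ | ⟨Q, a, m, rfl⟩) | ⟨f, m, rfl⟩)
      · exact (congrArg (· ∈ K0 g) (hDt m _)).mpr (Submodule.smul_mem _ _ (hA Q a (m - 1)))
      · exact (congrArg (· ∈ K0 g) (hDt m _)).mpr (Submodule.smul_mem _ _ (hB Q a (m - 1)))
      · exact (congrArg (· ∈ K0 g) (hDt m _)).mpr (Submodule.smul_mem _ _ (hK f (m - 1)))
    exact hle hx


end
end

section
/- The ℂ((z))-bilinear bracket on ǧ_p described below is skew-symmetric and satisfies the Jacobi identity; that is, ǧ_p is a Lie algebra over the field ℂ((z)). -/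
/-!
Statement 4 (Proposition 3.10, first part): the ℂ((z))-bilinear bracket on
`ǧ_p = (ℂ((z)) ⊗ (g ⊕ g¹) ⊗ ℂ[t,t⁻¹]) ⊕ ℂ((z))k` is skew-symmetric and satisfies
the Jacobi identity, so `ǧ_p` is a Lie algebra over the field ℂ((z)).
-/

open scoped TensorProduct

noncomputable section

/-- Scalar actions of `ℂ` and `ℂ((z))` on `ℂ((z))` commute. -/
instance : SMulCommClass ℂ (LaurentSeries ℂ) (LaurentSeries ℂ) where
  smul_comm c f x := by
    change c • (f * x) = f * (c • x)
    rw [← HahnSeries.C_mul_eq_smul, ← HahnSeries.C_mul_eq_smul, mul_left_comm]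

/-- The underlying ℂ((z))-vector space of `ǧ_p = (ℂ((z)) ⊗ (g ⊕ g¹) ⊗ ℂ[t,t⁻¹]) ⊕ ℂ((z))k`. -/
abbrev CpSp (g : Type) [AddCommGroup g] [Module ℂ g] : Type :=
  (ℤ →₀ (LaurentSeries ℂ ⊗[ℂ] (g × g))) × LaurentSeries ℂ

/-- Mathlib's pointwise negation of finitely supported functions (no longer found by inference). -/
instance instNegCp (g : Type) [AddCommGroup g] [Module ℂ g] :
    Neg (ℤ →₀ (LaurentSeries ℂ ⊗[ℂ] (g × g))) :=
  Finsupp.instNeg (G := LaurentSeries ℂ ⊗[ℂ] (g × g))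

variable {g : Type} [LieRing g] [LieAlgebra ℂ g]

/-- The element `a ⊗ tⁿ` of `ǧ_p` (with `a` in the first copy of `g`). -/
def elCA (a : g) (n : ℤ) : CpSp g :=
  (Finsupp.single n ((1 : LaurentSeries ℂ) ⊗ₜ[ℂ] (a, 0)), 0)

/-- The element `a¹ ⊗ tⁿ` of `ǧ_p` (with `a¹` in the second copy `g¹` of `g`). -/
def elCB (a : g) (n : ℤ) : CpSp g :=
  (Finsupp.single n ((1 : LaurentSeries ℂ) ⊗ₜ[ℂ] (0, a)), 0)

/-- The central element `k` of `ǧ_p`. -/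
def elCK (g : Type) [LieRing g] [LieAlgebra ℂ g] : CpSp g := (0, 1)

/-- `p^{(i)}(z)/i!` as an element of `ℂ((z))`, for `i ∈ ℤ`, interpreted as `0` for `i < 0`. -/
def hDiv (P : Polynomial ℂ) (i : ℤ) : LaurentSeries ℂ :=
  if 0 ≤ i then polyToL (Polynomial.hasseDeriv i.toNat P) else 0

theorem cp_ind (p : CpSp g → Prop) (hA : ∀ a n, p (elCA a n)) (hB : ∀ a n, p (elCB a n))
    (hK : p (elCK g)) (hadd : ∀ x y, p x → p y → p (x + y))
    (hsm : ∀ (f : LaurentSeries ℂ) x, p x → p (f • x)) (x : CpSp g) : p x := by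
  have h0 : p 0 := by
    have h1 := hsm 0 _ hK
    have h2 : (0 : LaurentSeries ℂ) • elCK g = 0 :=
      Prod.ext (zero_smul (LaurentSeries ℂ) (0 : ℤ →₀ (LaurentSeries ℂ ⊗[ℂ] (g × g))))
        (zero_smul (LaurentSeries ℂ) (1 : LaurentSeries ℂ))
    exact h2 ▸ h1
  obtain ⟨u, f⟩ := x
  have e : ((u, f) : CpSp g) = (u, 0) + f • elCK g := by
    ext1
    · simp [elCK]
    · simp [elCK]
  rw [e]
  refine hadd _ _ ?_ (hsm _ _ hK)
  induction u using Finsupp.induction_linear with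
  | zero => exact h0
  | add u v hu hv =>
    have : ((u + v, 0) : CpSp g) = (u, 0) + (v, 0) := by simp
    rw [this]
    exact hadd _ _ (hu (by ext1 <;> simp [elCK])) (hv (by ext1 <;> simp [elCK]))
  | single n t =>
    clear e
    induction t using TensorProduct.induction_on with
    | zero => rw [Finsupp.single_zero]; exact h0
    | add s t hs ht =>
      have : ((Finsupp.single n (s + t), 0) : CpSp g)
          = (Finsupp.single n s, 0) + (Finsupp.single n t, 0) := by
        simp [Finsupp.single_add]
      rw [this]
      exact hadd _ _ hs ht
    | tmul r ab =>
      obtain ⟨a, b⟩ := ab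
      have : ((Finsupp.single n (r ⊗ₜ[ℂ] (a, b)), 0) : CpSp g)
          = r • elCA a n + r • elCB b n := by
        ext1
        · simp only [elCA, elCB, Prod.smul_mk, Prod.mk_add_mk, Finsupp.smul_single,
            TensorProduct.smul_tmul', smul_eq_mul, mul_one, ← Finsupp.single_add,
            ← TensorProduct.tmul_add, add_zero, zero_add]
        · simp [elCA, elCB]
      rw [this]
      exact hadd _ _ (hsm _ _ (hA _ _)) (hsm _ _ (hB _ _))


theorem elCA_add (a b : g) (n : ℤ) : elCA (a + b) n = elCA a n + elCA b n := by
  have h : ((a + b, 0) : g × g) = (a, 0) + (b, 0) := by simp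
  refine Prod.ext ?_ (add_zero (0 : LaurentSeries ℂ)).symm
  change Finsupp.single n ((1 : LaurentSeries ℂ) ⊗ₜ[ℂ] ((a + b, 0) : g × g)) = _
  rw [h, TensorProduct.tmul_add]
  exact Finsupp.single_add _ _ _

theorem elCB_add (a b : g) (n : ℤ) : elCB (a + b) n = elCB a n + elCB b n := by
  have h : ((0, a + b) : g × g) = (0, a) + (0, b) := by simp
  refine Prod.ext ?_ (add_zero (0 : LaurentSeries ℂ)).symm
  change Finsupp.single n ((1 : LaurentSeries ℂ) ⊗ₜ[ℂ] ((0, a + b) : g × g)) = _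
  rw [h, TensorProduct.tmul_add]
  exact Finsupp.single_add _ _ _

theorem elCA_zero (n : ℤ) : elCA (0 : g) n = 0 := by
  refine Prod.ext ?_ rfl
  change Finsupp.single n ((1 : LaurentSeries ℂ) ⊗ₜ[ℂ] (0 : g × g)) = _
  rw [TensorProduct.tmul_zero]
  exact Finsupp.single_zero _

theorem elCB_zero (n : ℤ) : elCB (0 : g) n = 0 := by
  refine Prod.ext ?_ rfl
  change Finsupp.single n ((1 : LaurentSeries ℂ) ⊗ₜ[ℂ] (0 : g × g)) = _
  rw [TensorProduct.tmul_zero]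
  exact Finsupp.single_zero _

theorem cp_neg (x y : CpSp g) (h : x + y = 0) : x = -y := by
  have h1 : y + -y = 0 := by
    refine Prod.ext ?_ (add_neg_cancel y.2)
    refine Finsupp.ext fun n => ?_
    exact add_neg_cancel (y.1 n)
  calc x = x + (y + -y) := by rw [h1, add_zero]
    _ = (x + y) + -y := (add_assoc _ _ _).symm
    _ = -y := by rw [h, zero_add]

theorem cp_smulK (c : ℂ) (f : LaurentSeries ℂ) :
    c • (f • elCK g) = (HahnSeries.C c * f : LaurentSeries ℂ) • elCK g := by
  refine Prod.ext ?_ ?_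
  · refine Finsupp.ext fun n => ?_
    change c • (f • (0 : LaurentSeries ℂ ⊗[ℂ] (g × g)))
      = (HahnSeries.C c * f : LaurentSeries ℂ) • (0 : LaurentSeries ℂ ⊗[ℂ] (g × g))
    rw [smul_zero, smul_zero, smul_zero]
  · change c • (f * 1) = (HahnSeries.C c * f) * 1
    rw [mul_one, mul_one, HahnSeries.C_mul_eq_smul]

theorem cp_smulK1 (c : ℂ) :
    c • elCK g = (HahnSeries.C c : LaurentSeries ℂ) • elCK g := by
  refine Prod.ext ?_ ?_
  · refine Finsupp.ext fun n => ?_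
    change c • (0 : LaurentSeries ℂ ⊗[ℂ] (g × g))
      = (HahnSeries.C c : LaurentSeries ℂ) • (0 : LaurentSeries ℂ ⊗[ℂ] (g × g))
    rw [smul_zero, smul_zero]
  · change c • (1 : LaurentSeries ℂ) = (HahnSeries.C c) * 1
    rw [HahnSeries.C_mul_eq_smul]

theorem sum_delta (P : Polynomial ℂ) (n : ℤ) :
    ∑ j ∈ Finset.range (P.natDegree + 1),
      polyToL (Polynomial.hasseDeriv j P) * (if n + (j : ℤ) = 0 then (1 : LaurentSeries ℂ) else 0)
      = hDiv P (-n) := by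
  unfold hDiv
  split_ifs with h
  · obtain ⟨k, hk⟩ := Int.eq_ofNat_of_zero_le h
    have hn : n = -(k : ℤ) := by omega
    subst hn
    have : ∀ j : ℕ, (-(k : ℤ) + (j : ℤ) = 0) ↔ k = j := by intro j; omega
    simp only [this, mul_ite, mul_one, mul_zero, Finset.sum_ite_eq, Finset.mem_range, neg_neg,
      Int.toNat_natCast]
    split_ifs with hk'
    · rfl
    · rw [Polynomial.hasseDeriv_eq_zero_of_lt_natDegree P k (by omega)]
      simp [polyToL]
  · apply Finset.sum_eq_zero
    intro j _
    rw [if_neg (by omega), mul_zero]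


section abstr
variable {V : Type} [AddCommMonoid V] [Module (LaurentSeries ℂ) V]

/-- the sum term -/
def elS (X : g → ℤ → V) (P : Polynomial ℂ) (a : g) (n : ℤ) : V :=
  ∑ j ∈ Finset.range (P.natDegree + 1),
    polyToL (Polynomial.hasseDeriv j P) • X a (n + (j : ℤ))

theorem elS_add (X : g → ℤ → V) (hX : ∀ a b n, X (a + b) n = X a n + X b n)
    (P : Polynomial ℂ) (a b : g) (n : ℤ) :
    elS X P (a + b) n = elS X P a n + elS X P b n := by
  simp only [elS, hX, smul_add, Finset.sum_add_distrib]

theorem elS_zero (X : g → ℤ → V) (hX : ∀ n, X 0 n = 0) (P : Polynomial ℂ) (n : ℤ) :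
    elS X P (0 : g) n = 0 := by
  simp only [elS, hX, smul_zero, Finset.sum_const_zero]

theorem cp_abs
    (Φ : g →ₗ[ℂ] g →ₗ[ℂ] ℂ)
    (hsymm : ∀ a b : g, Φ a b = Φ b a)
    (hinv : ∀ a b c : g, Φ ⁅a, b⁆ c = Φ a ⁅b, c⁆)
    (P : Polynomial ℂ)
    (XA XB : g → ℤ → V) (K : V)
    (elCA_add : ∀ a b n, XA (a + b) n = XA a n + XA b n)
    (elCB_add : ∀ a b n, XB (a + b) n = XB a n + XB b n)
    (elCA_zero : ∀ n, XA 0 n = 0)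
    (elCB_zero : ∀ n, XB 0 n = 0)
    (ind : ∀ (p : V → Prop) (hA : ∀ a n, p (XA a n)) (hB : ∀ a n, p (XB a n))
      (hK : p K) (hadd : ∀ x y, p x → p y → p (x + y))
      (hsm : ∀ (f : LaurentSeries ℂ) x, p x → p (f • x)) (x : V), p x)
    (B : V →ₗ[LaurentSeries ℂ] V →ₗ[LaurentSeries ℂ] V)
    (hkl : ∀ x, B K x = 0)
    (hkr : ∀ x, B x K = 0)
    (haa' : ∀ (a b : g) (m n : ℤ), B (XA a m) (XA b n) = XA ⁅a, b⁆ (m + n)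
      + (HahnSeries.C ((m : ℂ) * Φ a b) *
        (if m + n = 0 then (1 : LaurentSeries ℂ) else 0)) • K)
    (hab : ∀ (a b : g) (m n : ℤ), B (XA a m) (XB b n) = XB ⁅a, b⁆ (m + n))
    (hba : ∀ (a b : g) (m n : ℤ), B (XB a m) (XA b n) = XB ⁅a, b⁆ (m + n))
    (hbb' : ∀ (a b : g) (m n : ℤ), B (XB a m) (XB b n) = elS XA P ⁅a, b⁆ (m + n)
      + (HahnSeries.C ((1 / 2 : ℂ) * ((m : ℂ) - (n : ℂ)) * Φ a b) * hDiv P (-(m + n))) • K) :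
    (∀ x y : V, B x y + B y x = 0) ∧
    (∀ x y z : V, B x (B y z) = B (B x y) z + B y (B x z)) := by
  have hzA : ∀ (a b : g) n, XA ⁅a, b⁆ n + XA ⁅b, a⁆ n = 0 := by
    intro a b n
    rw [← elCA_add, ← lie_skew, neg_add_cancel, elCA_zero]
  have hzB : ∀ (a b : g) n, XB ⁅a, b⁆ n + XB ⁅b, a⁆ n = 0 := by
    intro a b n
    rw [← elCB_add, ← lie_skew, neg_add_cancel, elCB_zero]
  have hzS : ∀ (a b : g) n, elS XA P ⁅a, b⁆ n + elS XA P ⁅b, a⁆ n = 0 := by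
    intro a b n
    rw [← elS_add XA elCA_add, ← lie_skew, neg_add_cancel, elS_zero XA elCA_zero]
  have skew : ∀ x y : V, B x y + B y x = 0 := by
    intro x y
    induction x using ind with
    | hadd u v hu hv =>
      have : B (u + v) y + B y (u + v) = (B u y + B y u) + (B v y + B y v) := by
        rw [map_add, map_add, LinearMap.add_apply]; abel
      rw [this, hu, hv, add_zero]
    | hsm f u hu =>
      rw [map_smul, map_smul, LinearMap.smul_apply, ← smul_add, hu, smul_zero]
    | hK => rw [hkl, hkr, add_zero]
    | hA a m =>
      induction y using ind with
      | hadd u v hu hv =>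
        have : B (XA a m) (u + v) + B (u + v) (XA a m)
            = (B (XA a m) u + B u (XA a m)) + (B (XA a m) v + B v (XA a m)) := by
          rw [map_add, map_add, LinearMap.add_apply]; abel
        rw [this, hu, hv, add_zero]
      | hsm f u hu =>
        rw [map_smul, map_smul, LinearMap.smul_apply, ← smul_add, hu, smul_zero]
      | hK => rw [hkl, hkr, add_zero]
      | hA b n =>
        rw [haa', haa', add_comm n m, add_add_add_comm, hzA, zero_add, ← add_smul, ← add_mul,
          ← map_add, hsymm b a, ← add_mul]
        split_ifs with h
        · have : (m : ℂ) + n = 0 := by exact_mod_cast h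
          rw [this]; simp
        · simp
      | hB b n => rw [hab, hba, add_comm n m, hzB]
    | hB a m =>
      induction y using ind with
      | hadd u v hu hv =>
        have : B (XB a m) (u + v) + B (u + v) (XB a m)
            = (B (XB a m) u + B u (XB a m)) + (B (XB a m) v + B v (XB a m)) := by
          rw [map_add, map_add, LinearMap.add_apply]; abel
        rw [this, hu, hv, add_zero]
      | hsm f u hu =>
        rw [map_smul, map_smul, LinearMap.smul_apply, ← smul_add, hu, smul_zero]
      | hK => rw [hkl, hkr, add_zero]
      | hA b n => rw [hab, hba, add_comm n m, hzB]
      | hB b n =>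
        rw [hbb', hbb', add_comm n m, add_add_add_comm, hzS, zero_add, ← add_smul, ← add_mul,
          ← map_add, hsymm b a]
        have : (1 / 2 : ℂ) * ((m : ℂ) - n) * Φ a b + 1 / 2 * ((n : ℂ) - m) * Φ a b = 0 := by ring
        rw [this]; simp
  have hAS : ∀ (a b : g) (m n : ℤ), B (XA a m) (elS XA P b n) = elS XA P ⁅a, b⁆ (m + n)
      + (HahnSeries.C ((m : ℂ) * Φ a b) * hDiv P (-(m + n))) • K := by
    intro a b m n
    rw [← sum_delta, elS, map_sum, elS, Finset.mul_sum, Finset.sum_smul, ← Finset.sum_add_distrib]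
    refine Finset.sum_congr rfl fun j _ => ?_
    rw [map_smul, haa', smul_add, smul_smul, add_assoc m n, mul_left_comm]
  have hBS : ∀ (a b : g) (m n : ℤ), B (XB a m) (elS XA P b n) = elS XB P ⁅a, b⁆ (m + n) := by
    intro a b m n
    rw [elS, map_sum, elS]
    refine Finset.sum_congr rfl fun j _ => ?_
    rw [map_smul, hba, add_assoc]
  refine ⟨skew, ?_⟩
  -- core cases
  have hneg : ∀ a b c : g, Φ b ⁅a, c⁆ = -Φ ⁅a, b⁆ c := by
    intro a b c
    rw [← hinv, ← lie_skew, map_neg, LinearMap.neg_apply]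
  have c1 : ∀ (a b c : g) (m n l : ℤ), B (XA a m) (B (XA b n) (XA c l))
      = B (B (XA a m) (XA b n)) (XA c l) + B (XA b n) (B (XA a m) (XA c l)) := by
    intro a b c m n l
    simp only [haa', map_add, map_smul, LinearMap.add_apply, LinearMap.smul_apply, hkl, hkr,
      smul_zero, add_zero]
    rw [leibniz_lie a b c, elCA_add, show n + (m + l) = m + (n + l) by ring,
      show m + n + l = m + (n + l) by ring, add_add_add_comm, ← add_smul,
      ← add_mul, ← map_add, ← hinv, hneg]
    congr 4
    push_cast; ring
  have c2 : ∀ (a b c : g) (m n l : ℤ), B (XA a m) (B (XA b n) (XB c l))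
      = B (B (XA a m) (XA b n)) (XB c l) + B (XA b n) (B (XA a m) (XB c l)) := by
    intro a b c m n l
    simp only [haa', hab, map_add, map_smul, LinearMap.add_apply, LinearMap.smul_apply, hkl, hkr,
      smul_zero, add_zero]
    rw [leibniz_lie a b c, elCB_add, show n + (m + l) = m + (n + l) by ring,
      show m + n + l = m + (n + l) by ring]
  have c3 : ∀ (a b c : g) (m n l : ℤ), B (XA a m) (B (XB b n) (XB c l))
      = B (B (XA a m) (XB b n)) (XB c l) + B (XB b n) (B (XA a m) (XB c l)) := by
    intro a b c m n l
    simp only [hbb', hab, hAS, map_add, map_smul, LinearMap.add_apply, LinearMap.smul_apply, hkl,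
      hkr, smul_zero, add_zero]
    rw [leibniz_lie a b c, elS_add XA elCA_add, show n + (m + l) = m + (n + l) by ring,
      show m + n + l = m + (n + l) by ring, add_add_add_comm, ← add_smul,
      ← add_mul, ← map_add, ← hinv, hneg]
    congr 4
    push_cast; ring
  have c4 : ∀ (a b c : g) (m n l : ℤ), B (XB a m) (B (XB b n) (XB c l))
      = B (B (XB a m) (XB b n)) (XB c l) + B (XB b n) (B (XB a m) (XB c l)) := by
    intro a b c m n l
    have h := skew (B (XB a m) (XB b n)) (XB c l)
    have h1 : B (XB a m) (B (XB b n) (XB c l)) + B (XB c l) (B (XB a m) (XB b n))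
        = B (XB b n) (B (XB a m) (XB c l)) := by
      simp only [hbb', hBS, map_add, map_smul, LinearMap.add_apply, LinearMap.smul_apply, hkl,
        hkr, smul_zero, add_zero]
      rw [show l + (m + n) = m + (n + l) by ring, show n + (m + l) = m + (n + l) by ring,
        ← elS_add XB elCB_add]
      congr 1
      rw [leibniz_lie a b c, ← lie_skew c ⁅a, b⁆]
      abel
    rw [← h1, add_left_comm, h, add_zero]
  -- permutations
  have p12 : ∀ x y z : V, B x (B y z) = B (B x y) z + B y (B x z) →
      B y (B x z) = B (B y x) z + B x (B y z) := by
    intro x y z h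
    have h1 : B (B x y) z + B (B y x) z = 0 := by
      rw [← LinearMap.add_apply, ← map_add, skew]; simp
    rw [h, ← add_assoc, add_comm (B (B y x) z), h1, zero_add]
  have p23 : ∀ x y z : V, B x (B y z) = B (B x y) z + B y (B x z) →
      B x (B z y) = B (B x z) y + B z (B x y) := by
    intro x y z h
    have h1 : B x (B z y) + B x (B y z) = 0 := by
      rw [← map_add, skew]; simp
    have h2 := skew (B x z) y
    have h3 := skew z (B x y)
    have h4 : B x (B z y) + (B (B x y) z + B y (B x z)) = 0 := by rw [← h, h1]
    have h5 : (B (B x z) y + B z (B x y)) + (B (B x y) z + B y (B x z)) = 0 := by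
      calc _ = (B (B x z) y + B y (B x z)) + (B z (B x y) + B (B x y) z) := by abel
        _ = 0 := by rw [h2, h3, add_zero]
    rw [← add_zero (B x (B z y)), ← h5, add_left_comm, h4, add_zero]
  have jadd : ∀ x y u v : V, B x (B y u) = B (B x y) u + B y (B x u) →
      B x (B y v) = B (B x y) v + B y (B x v) →
      B x (B y (u + v)) = B (B x y) (u + v) + B y (B x (u + v)) := by
    intro x y u v hu hv
    simp only [map_add, hu, hv]
    abel
  have jsm : ∀ (x y : V) (f : LaurentSeries ℂ) (u : V),
      B x (B y u) = B (B x y) u + B y (B x u) →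
      B x (B y (f • u)) = B (B x y) (f • u) + B y (B x (f • u)) := by
    intro x y f u hu
    simp only [map_smul, hu, smul_add]
  have jK : ∀ x y : V, B x (B y K) = B (B x y) K + B y (B x K) := by
    intro x y
    simp only [hkr, map_zero, add_zero]
  intro x y z
  induction z using ind with
  | hadd u v hu hv => exact jadd _ _ _ _ hu hv
  | hsm f u hu => exact jsm _ _ _ _ hu
  | hK => exact jK _ _
  | hA c l =>
    apply p23
    induction y using ind with
    | hadd u v hu hv => exact jadd _ _ _ _ hu hv
    | hsm f u hu => exact jsm _ _ _ _ hu
    | hK => exact jK _ _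
    | hA b n =>
      apply p12
      apply p23
      induction x using ind with
      | hadd u v hu hv => exact jadd _ _ _ _ hu hv
      | hsm f u hu => exact jsm _ _ _ _ hu
      | hK => exact jK _ _
      | hA a m => exact c1 _ _ _ _ _ _
      | hB a m => exact c2 _ _ _ _ _ _
    | hB b n =>
      apply p12
      apply p23
      induction x using ind with
      | hadd u v hu hv => exact jadd _ _ _ _ hu hv
      | hsm f u hu => exact jsm _ _ _ _ hu
      | hK => exact jK _ _
      | hA a m => exact p23 _ _ _ (c2 _ _ _ _ _ _)
      | hB a m => exact c3 _ _ _ _ _ _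
  | hB c l =>
    apply p23
    induction y using ind with
    | hadd u v hu hv => exact jadd _ _ _ _ hu hv
    | hsm f u hu => exact jsm _ _ _ _ hu
    | hK => exact jK _ _
    | hA b n =>
      apply p12
      apply p23
      induction x using ind with
      | hadd u v hu hv => exact jadd _ _ _ _ hu hv
      | hsm f u hu => exact jsm _ _ _ _ hu
      | hK => exact jK _ _
      | hA a m => exact p12 _ _ _ (p23 _ _ _ (c2 _ _ _ _ _ _))
      | hB a m => exact p12 _ _ _ (c3 _ _ _ _ _ _)
    | hB b n =>
      apply p12
      apply p23
      induction x using ind with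
      | hadd u v hu hv => exact jadd _ _ _ _ hu hv
      | hsm f u hu => exact jsm _ _ _ _ hu
      | hK => exact jK _ _
      | hA a m => exact p23 _ _ _ (p12 _ _ _ (c3 _ _ _ _ _ _))
      | hB a m => exact c4 _ _ _ _ _ _

end abstr

theorem statement4
    (Φ : g →ₗ[ℂ] g →ₗ[ℂ] ℂ)
    (hsymm : ∀ a b : g, Φ a b = Φ b a)
    (hinv : ∀ a b c : g, Φ ⁅a, b⁆ c = Φ a ⁅b, c⁆)
    (hnondeg : ∀ a : g, (∀ b : g, Φ a b = 0) → a = 0)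
    (P : Polynomial ℂ)
    -- the ℂ((z))-bilinear bracket of `ǧ_p`, specified on the generating elements:
    (B : CpSp g →ₗ[LaurentSeries ℂ] CpSp g →ₗ[LaurentSeries ℂ] CpSp g)
    -- `k` is central:
    (hkl : ∀ x : CpSp g, B (elCK g) x = 0)
    (hkr : ∀ x : CpSp g, B x (elCK g) = 0)
    -- `[a⊗tᵐ, b⊗tⁿ] = [a,b]⊗tᵐ⁺ⁿ + m⟨a,b⟩δ_{m+n,0}k`:
    (haa : ∀ (a b : g) (m n : ℤ),
      B (elCA a m) (elCA b n)
        = elCA ⁅a, b⁆ (m + n)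
          + (if m + n = 0 then ((m : ℂ) * Φ a b) • elCK g else 0))
    -- `[a⊗tᵐ, b¹⊗tⁿ] = [a¹⊗tᵐ, b⊗tⁿ] = [a,b]¹⊗tᵐ⁺ⁿ`:
    (hab : ∀ (a b : g) (m n : ℤ), B (elCA a m) (elCB b n) = elCB ⁅a, b⁆ (m + n))
    (hba : ∀ (a b : g) (m n : ℤ), B (elCB a m) (elCA b n) = elCB ⁅a, b⁆ (m + n))
    -- `[a¹⊗tᵐ, b¹⊗tⁿ] = Σ_{j≥0} (p^{(j)}(z)/j!)[a,b]⊗tᵐ⁺ⁿ⁺ʲ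
    --                  + (1/2)(m−n)⟨a,b⟩(p^{(−m−n)}(z)/(−m−n)!)k`:
    (hbb : ∀ (a b : g) (m n : ℤ),
      B (elCB a m) (elCB b n)
        = (∑ j ∈ Finset.range (P.natDegree + 1),
            polyToL (Polynomial.hasseDeriv j P) • elCA ⁅a, b⁆ (m + n + (j : ℤ)))
          + ((1 / 2 : ℂ) * ((m : ℂ) - (n : ℂ)) * Φ a b) • (hDiv P (-m - n) • elCK g)) :
    -- the bracket is skew-symmetric:
    (∀ x y : CpSp g, B x y = -B y x) ∧
    -- and satisfies the Jacobi identity, i.e. `ǧ_p` is a Lie algebra over `ℂ((z))`: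
    (∀ x y z : CpSp g, B x (B y z) = B (B x y) z + B y (B x z)) := by
  have h := cp_abs Φ hsymm hinv P elCA elCB (elCK g) elCA_add elCB_add elCA_zero elCB_zero
    cp_ind B hkl hkr (by
      intro a b m n
      rw [haa]
      congr 1
      split_ifs
      · rw [mul_one]
        exact cp_smulK1 _
      · rw [mul_zero]
        exact (zero_smul (LaurentSeries ℂ) (elCK g)).symm) hab hba (by
      intro a b m n
      rw [hbb, cp_smulK, neg_add']
      rfl)
  exact ⟨fun x y => cp_neg _ _ (h.1 x y), h.2⟩

end
end

section
/- Let W be a module for the Lie algebra ǧ_p over ℂ((z)), and let w₀ ∈ W be such that the only ǧ_p-submodule of W containing w₀ is W itself, and such that (f(z)u⊗tⁿ)·w₀ = 0 for all u ∈ g ∪ g¹, f(z) ∈ ℂ((z)) and all n ≥ 0. Then W is a restricted module: for every w ∈ W there exists N ∈ ℤ such that ǧ_p[n]·w = 0 for all n ≥ N. -/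
/-!
Statement 7 (Lemma 3.14): if a `ǧ_p`-module `W` is generated by a vector `w₀`
annihilated by all `f(z)u⊗tⁿ` with `n ≥ 0` (`u ∈ g ∪ g¹`), then `W` is a
restricted module: for each `w ∈ W`, `ǧ_p[n]·w = 0` for all sufficiently large `n`.
-/

open scoped TensorProduct

noncomputable section

variable {g : Type} [LieRing g] [LieAlgebra ℂ g]

/-- The subspace `ǧ_p[n]`: the `ℂ((z))`-span of `ℂ((z))(g+g¹)⊗tᵐℂ[t]` for `m ≥ n`,
together with `ℂ((z))k` when `n ≤ 0`. -/
def cFilt (g : Type) [LieRing g] [LieAlgebra ℂ g] (n : ℤ) : Submodule (LaurentSeries ℂ) (CpSp g) :=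
  Submodule.span (LaurentSeries ℂ)
    ({x | ∃ (a : g) (m : ℤ), n ≤ m ∧ (x = elCA a m ∨ x = elCB a m)}
      ∪ {x | n ≤ 0 ∧ x = elCK g})

theorem span_aux (g : Type) [LieRing g] [LieAlgebra ℂ g]
    (T : Submodule (LaurentSeries ℂ) (CpSp g))
    (hA : ∀ (a : g) (m : ℤ), elCA a m ∈ T) (hB : ∀ (a : g) (m : ℤ), elCB a m ∈ T)
    (hK : elCK g ∈ T) (x : CpSp g) : x ∈ T := by
  have key : ∀ (n : ℤ) (y : LaurentSeries ℂ ⊗[ℂ] (g × g)),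
      ((Finsupp.single n y, 0) : CpSp g) ∈ T := by
    intro n y
    induction y using TensorProduct.induction_on with
    | zero => rw [Finsupp.single_zero]; exact T.zero_mem
    | tmul r ab =>
      obtain ⟨a, b⟩ := ab
      have h : ((Finsupp.single n (r ⊗ₜ[ℂ] (a, b)), 0) : CpSp g)
          = r • elCA a n + r • elCB b n := by
        unfold elCA elCB
        rw [Prod.smul_mk, Prod.smul_mk, Prod.mk_add_mk, Finsupp.smul_single, Finsupp.smul_single,
          ← Finsupp.single_add, TensorProduct.smul_tmul', TensorProduct.smul_tmul',
          ← TensorProduct.tmul_add]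
        simp
      rw [h]
      exact T.add_mem (T.smul_mem _ (hA _ _)) (T.smul_mem _ (hB _ _))
    | add u v hu hv =>
      have := T.add_mem hu hv
      rw [Prod.mk_add_mk, ← Finsupp.single_add, add_zero] at this
      exact this
  obtain ⟨f, c⟩ := x
  have h1 : ((f, 0) : CpSp g) ∈ T := by
    induction f using Finsupp.induction_linear with
    | zero => exact T.zero_mem
    | add u v hu hv =>
      have := T.add_mem hu hv
      rw [Prod.mk_add_mk, add_zero] at this
      exact this
    | single n y => exact key n y
  have h2 : ((0, c) : CpSp g) ∈ T := by
    have := T.smul_mem c hK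
    unfold elCK at this
    rw [Prod.smul_mk, smul_zero, smul_eq_mul, mul_one] at this
    exact this
  have := T.add_mem h1 h2
  rw [Prod.mk_add_mk, add_zero, zero_add] at this
  exact this

theorem statement7
    (Φ : g →ₗ[ℂ] g →ₗ[ℂ] ℂ)
    (hsymm : ∀ a b : g, Φ a b = Φ b a)
    (hinv : ∀ a b c : g, Φ ⁅a, b⁆ c = Φ a ⁅b, c⁆)
    (hnondeg : ∀ a : g, (∀ b : g, Φ a b = 0) → a = 0)
    (P : Polynomial ℂ)
    -- the ℂ((z))-bilinear bracket of `ǧ_p`, specified on the generating elements: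
    (B : CpSp g →ₗ[LaurentSeries ℂ] CpSp g →ₗ[LaurentSeries ℂ] CpSp g)
    -- `k` is central:
    (hkl : ∀ x : CpSp g, B (elCK g) x = 0)
    (hkr : ∀ x : CpSp g, B x (elCK g) = 0)
    -- `[a⊗tᵐ, b⊗tⁿ] = [a,b]⊗tᵐ⁺ⁿ + m⟨a,b⟩δ_{m+n,0}k`:
    (haa : ∀ (a b : g) (m n : ℤ),
      B (elCA a m) (elCA b n)
        = elCA ⁅a, b⁆ (m + n)
          + (if m + n = 0 then ((m : ℂ) * Φ a b) • elCK g else 0))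
    -- `[a⊗tᵐ, b¹⊗tⁿ] = [a¹⊗tᵐ, b⊗tⁿ] = [a,b]¹⊗tᵐ⁺ⁿ`:
    (hab : ∀ (a b : g) (m n : ℤ), B (elCA a m) (elCB b n) = elCB ⁅a, b⁆ (m + n))
    (hba : ∀ (a b : g) (m n : ℤ), B (elCB a m) (elCA b n) = elCB ⁅a, b⁆ (m + n))
    -- `[a¹⊗tᵐ, b¹⊗tⁿ] = Σ_{j≥0} (p^{(j)}(z)/j!)[a,b]⊗tᵐ⁺ⁿ⁺ʲ
    --                  + (1/2)(m−n)⟨a,b⟩(p^{(−m−n)}(z)/(−m−n)!)k`: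
    (hbb : ∀ (a b : g) (m n : ℤ),
      B (elCB a m) (elCB b n)
        = (∑ j ∈ Finset.range (P.natDegree + 1),
            polyToL (Polynomial.hasseDeriv j P) • elCA ⁅a, b⁆ (m + n + (j : ℤ)))
          + ((1 / 2 : ℂ) * ((m : ℂ) - (n : ℂ)) * Φ a b) • (hDiv P (-m - n) • elCK g))
    -- a `ǧ_p`-module `W` (a ℂ((z))-vector space with a ℂ((z))-bilinear Lie action):
    {W : Type} [AddCommGroup W] [Module (LaurentSeries ℂ) W]
    (ρ : CpSp g →ₗ[LaurentSeries ℂ] W →ₗ[LaurentSeries ℂ] W)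
    (hLie : ∀ x y : CpSp g, ρ (B x y) = ρ x ∘ₗ ρ y - ρ y ∘ₗ ρ x)
    -- a vector `w₀` such that the only `ǧ_p`-submodule of `W` containing `w₀` is `W`:
    (w₀ : W)
    (hgen : ∀ S : Submodule (LaurentSeries ℂ) W,
      (∀ x : CpSp g, ∀ w ∈ S, ρ x w ∈ S) → w₀ ∈ S → S = ⊤)
    -- with `(f(z)u⊗tⁿ)·w₀ = 0` for all `u ∈ g ∪ g¹`, `f(z) ∈ ℂ((z))` and `n ≥ 0`:
    (hvac : ∀ (f : LaurentSeries ℂ) (a : g) (n : ℤ), 0 ≤ n →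
      ρ (f • elCA a n) w₀ = 0 ∧ ρ (f • elCB a n) w₀ = 0) :
    -- then `W` is restricted:
    ∀ w : W, ∃ N : ℤ, ∀ n : ℤ, N ≤ n → ∀ x ∈ cFilt g n, ρ x w = 0 := by
  have comm : ∀ (x y : CpSp g) (w : W), ρ x (ρ y w) = ρ (B x y) w + ρ y (ρ x w) := by
    intro x y w
    rw [hLie]
    simp
  let S : Submodule (LaurentSeries ℂ) W :=
    { carrier := {w | ∃ N : ℤ, ∀ (a : g) (m : ℤ), N ≤ m → ρ (elCA a m) w = 0 ∧ ρ (elCB a m) w = 0}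
      add_mem' := by
        rintro u v ⟨N, hN⟩ ⟨M, hM⟩
        refine ⟨max N M, fun a m hm => ?_⟩
        have h1 := hN a m (le_trans (le_max_left _ _) hm)
        have h2 := hM a m (le_trans (le_max_right _ _) hm)
        rw [map_add, map_add, h1.1, h1.2, h2.1, h2.2]
        simp
      zero_mem' := ⟨0, fun a m _ => by simp⟩
      smul_mem' := by
        rintro c u ⟨N, hN⟩
        refine ⟨N, fun a m hm => ?_⟩
        rw [map_smul, map_smul, (hN a m hm).1, (hN a m hm).2]
        simp }
  have hS : S = ⊤ := by
    apply hgen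
    · intro x w hw
      let T : Submodule (LaurentSeries ℂ) (CpSp g) := S.comap (ρ.flip w)
      change x ∈ T
      obtain ⟨N, hN⟩ := hw
      apply span_aux
      · intro b n
        refine ⟨max N (max (N - n) (1 - n)), fun a m hm => ?_⟩
        have hm1 : N ≤ m := by omega
        have hm2 : N ≤ m + n := by omega
        have hm3 : ¬ (m + n = 0) := by omega
        change ρ (elCA a m) (ρ (elCA b n) w) = 0 ∧ ρ (elCB a m) (ρ (elCA b n) w) = 0
        rw [comm (elCA a m), comm (elCB a m), haa, hba, if_neg hm3, add_zero, (hN _ _ hm1).1, (hN _ _ hm1).2,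
          (hN _ _ hm2).1, (hN _ _ hm2).2]
        simp
      · intro b n
        refine ⟨max N (max (N - n) (1 - n)), fun a m hm => ?_⟩
        have hm1 : N ≤ m := by omega
        have hm2 : N ≤ m + n := by omega
        have hm3 : ¬ (0 ≤ -m - n) := by omega
        change ρ (elCA a m) (ρ (elCB b n) w) = 0 ∧ ρ (elCB a m) (ρ (elCB b n) w) = 0
        have hd : hDiv P (-m - n) = 0 := by
          unfold hDiv
          rw [if_neg hm3]
        have hz : hDiv P (-m - n) • elCK g = 0 := by
          rw [hd]
          exact zero_smul (LaurentSeries ℂ) (elCK g)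
        rw [comm (elCA a m), comm (elCB a m), hab, hbb, hz, smul_zero, add_zero, (hN _ _ hm1).1,
          (hN _ _ hm1).2, (hN _ _ hm2).2, map_sum, LinearMap.sum_apply]
        refine ⟨by simp, ?_⟩
        rw [map_zero, add_zero]
        refine Finset.sum_eq_zero fun j _ => ?_
        rw [map_smul, LinearMap.smul_apply, (hN _ _ (by omega)).1, smul_zero]
      · refine ⟨N, fun a m hm => ?_⟩
        change ρ (elCA a m) (ρ (elCK g) w) = 0 ∧ ρ (elCB a m) (ρ (elCK g) w) = 0
        rw [comm (elCA a m), comm (elCB a m), hkr, hkr, (hN _ _ hm).1, (hN _ _ hm).2]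
        simp
    · refine ⟨0, fun a m hm => ?_⟩
      have := hvac 1 a m hm
      rwa [one_smul, one_smul] at this
  intro w
  have hw : w ∈ S := hS ▸ Submodule.mem_top
  obtain ⟨N, hN⟩ := hw
  refine ⟨max N 1, fun n hn x hx => ?_⟩
  have hle : cFilt g n ≤ LinearMap.ker (ρ.flip w) := by
    refine Submodule.span_le.2 ?_
    rintro y (⟨a, m, hm, rfl | rfl⟩ | ⟨h0, _⟩)
    · exact (hN a m (by omega)).1
    · exact (hN a m (by omega)).2
    · omega
  exact hle hx

end
end

section
/- Assume g ≠ 0 and let p(x) ∈ ℂ[x] be a nonconstant polynomial (for instance p(x) = x³ − 2βx² + x with β ∈ ℂ, the elliptic case). Suppose W is a nonzero restricted ĝ_p-module of level ℓ equipped with a vector w₀ ∈ W and a ℂ-linear operator D on W such that: the only ℂ-subspace of W containing w₀ and stable under all operators u(n) (u ∈ g ∪ g¹, n ∈ ℤ) is W itself; Dw₀ = 0; u(n)w₀ = 0 for all u ∈ g ∪ g¹ and n ≥ 0; and [D, u(n)] = −n·u(n−1) for all u ∈ g ∪ g¹ and n ∈ ℤ. Then ℓ = 0. Furthermore, if [g,g]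 = g, then W is one-dimensional and every element of ĝ_p acts as zero on W. -/
/-!
Statement 8 (Proposition 3.5): for `g ≠ 0` and `p` a nonconstant polynomial, a nonzero
restricted `ĝ_p`-module of level `ℓ` that admits a vacuum-like vector `w₀` and a
compatible operator `D` forces `ℓ = 0`; and if moreover `[g,g] = g` then `W` is the
one-dimensional trivial module.
-/

noncomputable section

/-- The underlying ℂ-vector space of `ĝ_p = ((g ⊕ g¹) ⊗ ℂ[t,t⁻¹]) ⊕ ℂk`:
an element supported at `n ∈ ℤ` with value `(a,b)` (and last component `c`)
represents `a ⊗ tⁿ + b¹ ⊗ tⁿ + c·k`. -/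
abbrev HpSp (g : Type) [AddCommGroup g] [Module ℂ g] : Type :=
  (ℤ →₀ (g × g)) × ℂ

variable {g : Type} [LieRing g] [LieAlgebra ℂ g]

/-- The element `a ⊗ tⁿ` of `ĝ_p` (with `a` in the first copy of `g`). -/
def elA (a : g) (n : ℤ) : HpSp g := (Finsupp.single n (a, 0), 0)

/-- The element `a¹ ⊗ tⁿ` of `ĝ_p` (with `a¹` in the second copy `g¹` of `g`). -/
def elB (a : g) (n : ℤ) : HpSp g := (Finsupp.single n (0, a), 0)

/-- The central element `k` of `ĝ_p`. -/
def elK (g : Type) [LieRing g] [LieAlgebra ℂ g] : HpSp g := (0, 1)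

/-- `p_i` for `i ∈ ℤ`: the coefficient of `xⁱ` in `P`, zero for `i < 0`. -/
def coeffZ (P : Polynomial ℂ) (i : ℤ) : ℂ := if 0 ≤ i then P.coeff i.toNat else 0

theorem statement8

    (Φ : g →ₗ[ℂ] g →ₗ[ℂ] ℂ)
    (hsymm : ∀ a b : g, Φ a b = Φ b a)
    (hinv : ∀ a b c : g, Φ ⁅a, b⁆ c = Φ a ⁅b, c⁆)
    (hnondeg : ∀ a : g, (∀ b : g, Φ a b = 0) → a = 0)
    (P : Polynomial ℂ)
    -- the ℂ-bilinear bracket of `ĝ_p`, specified on spanning elements: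
    (B : HpSp g →ₗ[ℂ] HpSp g →ₗ[ℂ] HpSp g)
    -- `k` is central:
    (hkl : ∀ x : HpSp g, B (elK g) x = 0)
    (hkr : ∀ x : HpSp g, B x (elK g) = 0)
    -- `[a⊗tᵐ, b⊗tⁿ] = [a,b]⊗tᵐ⁺ⁿ + m⟨a,b⟩δ_{m+n,0}k`:
    (haa : ∀ (a b : g) (m n : ℤ),
      B (elA a m) (elA b n)
        = elA ⁅a, b⁆ (m + n)
          + ((m : ℂ) * Φ a b * (if m + n = 0 then 1 else 0)) • elK g)
    -- `[a⊗tᵐ, b¹⊗tⁿ] = [a¹⊗tᵐ, b⊗tⁿ] = [a,b]¹⊗tᵐ⁺ⁿ`: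
    (hab : ∀ (a b : g) (m n : ℤ), B (elA a m) (elB b n) = elB ⁅a, b⁆ (m + n))
    (hba : ∀ (a b : g) (m n : ℤ), B (elB a m) (elA b n) = elB ⁅a, b⁆ (m + n))
    -- `[a¹⊗tᵐ, b¹⊗tⁿ] = Σ_{j≥0} p_j [a,b]⊗tᵐ⁺ⁿ⁺ʲ + (1/2)(m−n)⟨a,b⟩p_{−m−n}k`:
    (hbb : ∀ (a b : g) (m n : ℤ),
      B (elB a m) (elB b n)
        = P.sum (fun j c => c • elA ⁅a, b⁆ (m + n + (j : ℤ)))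
          + ((1 / 2 : ℂ) * ((m : ℂ) - (n : ℂ)) * Φ a b * coeffZ P (-m - n)) • elK g)    -- `g ≠ 0` and `p` is nonconstant:
    (hg : Nontrivial g)
    (hP : P.natDegree ≠ 0)
    -- a nonzero ℂ-vector space `W`:
    {W : Type} [AddCommGroup W] [Module ℂ W]
    (hW : ∃ w : W, w ≠ 0)
    -- with a `ĝ_p`-module structure:
    (ρ : HpSp g →ₗ[ℂ] W →ₗ[ℂ] W)
    (hLie : ∀ x y : HpSp g, ρ (B x y) = ρ x ∘ₗ ρ y - ρ y ∘ₗ ρ x)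
    -- of level `ℓ`:
    (ℓ : ℂ)
    (hlevel : ρ (elK g) = ℓ • LinearMap.id)
    -- which is restricted:
    (hres : ∀ (a : g) (w : W), ∃ N : ℤ, ∀ n : ℤ, N ≤ n →
      ρ (elA a n) w = 0 ∧ ρ (elB a n) w = 0)
    -- equipped with a vector `w₀` generating `W` under the operators `u(n)`:
    (w₀ : W)
    (hgen : ∀ S : Submodule ℂ W,
      (∀ (a : g) (n : ℤ), ∀ w ∈ S, ρ (elA a n) w ∈ S ∧ ρ (elB a n) w ∈ S) →
      w₀ ∈ S → S = ⊤)
    -- and a ℂ-linear operator `D` with `Dw₀ = 0`: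
    (D : W →ₗ[ℂ] W)
    (hD0 : D w₀ = 0)
    -- `u(n)w₀ = 0` for `n ≥ 0`:
    (hvac : ∀ (a : g) (n : ℤ), 0 ≤ n → ρ (elA a n) w₀ = 0 ∧ ρ (elB a n) w₀ = 0)
    -- and `[D, u(n)] = −n·u(n−1)`:
    (hcommA : ∀ (a : g) (n : ℤ),
      D ∘ₗ ρ (elA a n) - ρ (elA a n) ∘ₗ D = (-n : ℂ) • ρ (elA a (n - 1)))
    (hcommB : ∀ (a : g) (n : ℤ),
      D ∘ₗ ρ (elB a n) - ρ (elB a n) ∘ₗ D = (-n : ℂ) • ρ (elB a (n - 1))) :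
    -- then `ℓ = 0`:
    ℓ = 0 ∧
    -- and if `[g,g] = g`, then `W` is the one-dimensional trivial module:
    ((Submodule.span ℂ {x : g | ∃ a b : g, ⁅a, b⁆ = x} = ⊤) →
      Module.finrank ℂ W = 1 ∧ ∀ x : HpSp g, ρ x = 0) := by
  have hδA : ∀ (a : g) (n : ℤ), D * ρ (elA a n) - ρ (elA a n) * D = (-n : ℂ) • ρ (elA a (n - 1)) := hcommA
  have hδB : ∀ (a : g) (n : ℤ), D * ρ (elB a n) - ρ (elB a n) * D = (-n : ℂ) • ρ (elB a (n - 1)) := hcommB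
  have hL : ∀ x y : HpSp g, ρ (B x y) = ρ x * ρ y - ρ y * ρ x := hLie
  have hlev : ρ (elK g) = ℓ • (1 : Module.End ℂ W) := hlevel
  have hF : ∀ (a b : g) (m n : ℤ), ρ (elB a m) * ρ (elB b n) - ρ (elB b n) * ρ (elB a m)
      = ∑ j ∈ P.support, P.coeff j • ρ (elA ⁅a, b⁆ (m + n + (j : ℤ)))
        + ((1 / 2 : ℂ) * ((m : ℂ) - (n : ℂ)) * Φ a b * coeffZ P (-m - n) * ℓ) •
          (1 : Module.End ℂ W) := by
    intro a b m n
    rw [← hL, hbb, map_add, map_smul, hlev, Polynomial.sum_def, map_sum, smul_smul]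
    simp only [map_smul]
  have hδT : ∀ (c : g) (s : ℤ),
      D * (∑ j ∈ P.support, P.coeff j • ρ (elA c (s + (j : ℤ))))
        - (∑ j ∈ P.support, P.coeff j • ρ (elA c (s + (j : ℤ)))) * D
      = (-s : ℂ) • (∑ j ∈ P.support, P.coeff j • ρ (elA c (s - 1 + (j : ℤ))))
        - ∑ j ∈ P.support, (P.coeff j * (j : ℂ)) • ρ (elA c (s - 1 + (j : ℤ))) := by
    intro c s
    rw [Finset.mul_sum, Finset.sum_mul, ← Finset.sum_sub_distrib, Finset.smul_sum,
      ← Finset.sum_sub_distrib]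
    refine Finset.sum_congr rfl fun j _ => ?_
    rw [mul_smul_comm, smul_mul_assoc, ← smul_sub, hδA, smul_smul, smul_smul, ← sub_smul,
      show s + (j : ℤ) - 1 = s - 1 + (j : ℤ) by ring]
    congr 1
    push_cast
    ring
  have hkey : ∀ (a b : g) (m n : ℤ),
      ∑ j ∈ P.support, (P.coeff j * (j : ℂ)) • ρ (elA ⁅a, b⁆ (m + n - 1 + (j : ℤ)))
      = ((1 / 2 : ℂ) * ((m : ℂ) - n) * ((m : ℂ) + n - 1) * Φ a b * coeffZ P (1 - (m + n)) * ℓ) •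
          (1 : Module.End ℂ W) := by
    intro a b m n
    have h1 := hF a b m n
    have h2 := hF a b (m - 1) n
    have h3 := hF a b m (n - 1)
    have h4 := hδT ⁅a, b⁆ (m + n)
    have h5 := hδB a m
    have h6 := hδB b n
    rw [show m - 1 + n = m + n - 1 by ring, show -(m - 1) - n = 1 - (m + n) by ring] at h2
    rw [show m + (n - 1) = m + n - 1 by ring, show -m - (n - 1) = 1 - (m + n) by ring] at h3
    generalize ρ (elB a m) = X at *
    generalize ρ (elB b n) = Y at *
    generalize ρ (elB a (m-1)) = X' at *
    generalize ρ (elB b (n-1)) = Y' at *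
    generalize (∑ j ∈ P.support, (P.coeff j * (j : ℂ)) • ρ (elA ⁅a, b⁆ (m + n - 1 + (j : ℤ)))) = T' at *
    generalize (∑ j ∈ P.support, P.coeff j • ρ (elA ⁅a, b⁆ (m + n - 1 + (j : ℤ)))) = T1 at *
    generalize (∑ j ∈ P.support, P.coeff j • ρ (elA ⁅a, b⁆ (m + n + (j : ℤ)))) = T0 at *
    have e1 : D * (X * Y - Y * X) - (X * Y - Y * X) * D
        = ((D * X - X * D) * Y - Y * (D * X - X * D))
          + (X * (D * Y - Y * D) - (D * Y - Y * D) * X) := by noncomm_ring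
    have e2 : D * (X * Y - Y * X) - (X * Y - Y * X) * D = D * T0 - T0 * D := by
      rw [h1, mul_add, add_mul, mul_smul_comm, smul_mul_assoc, one_mul, mul_one]
      abel
    have e3 : T' = (-((m + n : ℤ) : ℂ)) • T1 - (D * T0 - T0 * D) := by rw [h4]; abel
    rw [e3, ← e2, e1, h5, h6, smul_mul_assoc, mul_smul_comm, smul_mul_assoc, mul_smul_comm,
      ← smul_sub, ← smul_sub, h2, h3]
    push_cast
    module
  have hw0 : w₀ ≠ 0 := by
    rintro rfl
    have h := hgen ⊥ (by intro a n w hw; simp at hw; simp [hw]) (by simp)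
    obtain ⟨w, hw⟩ := hW
    have : w ∈ (⊥ : Submodule ℂ W) := by rw [h]; trivial
    exact hw (by simpa using this)
  have hlc : P.coeff P.natDegree ≠ 0 := by
    intro h
    have : P = 0 := Polynomial.leadingCoeff_eq_zero.mp h
    simp [this] at hP
  have hℓ : ℓ = 0 := by
    obtain ⟨a, ha⟩ := exists_ne (0 : g)
    obtain ⟨b, hb⟩ : ∃ b, Φ a b ≠ 0 := by
      by_contra! h
      exact ha (hnondeg a h)
    have k1 := hkey a b 0 (1 - P.natDegree)
    have k2 := hkey a b 1 (-P.natDegree)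
    rw [show (0 : ℤ) + (1 - P.natDegree) = 1 + -P.natDegree by ring, k2] at k1
    have k3 := congrArg (fun f : Module.End ℂ W => f w₀) k1
    simp only [LinearMap.smul_apply, Module.End.one_apply] at k3
    have k4 := smul_left_injective ℂ hw0 k3
    have hc : coeffZ P (1 - (1 + -(P.natDegree : ℤ))) = P.coeff P.natDegree := by
      rw [show 1 - (1 + -(P.natDegree : ℤ)) = (P.natDegree : ℤ) by ring]
      simp [coeffZ]
    rw [hc] at k4
    push_cast at k4
    have k5 : (P.natDegree : ℂ) * Φ a b * P.coeff P.natDegree * ℓ = 0 := by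
      linear_combination (-1 : ℂ) * k4
    have hd : (P.natDegree : ℂ) ≠ 0 := by exact_mod_cast hP
    exact (mul_eq_zero.mp k5).resolve_left (mul_ne_zero (mul_ne_zero hd hb) hlc)
  refine ⟨hℓ, fun hperf => ?_⟩
  have hex : ∃ j, j ≠ 0 ∧ P.coeff j ≠ 0 := ⟨_, hP, hlc⟩
  classical
  have hj := Nat.find_spec hex
  have hjmin : ∀ i, i < Nat.find hex → (P.coeff i * (i : ℂ)) = 0 := by
    intro i hi
    have := Nat.find_min hex hi
    by_cases h0 : i = 0
    · simp [h0]
    · have : P.coeff i = 0 := by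
        by_contra h
        exact this ⟨h0, h⟩
      simp [this]
  generalize Nat.find hex = j0 at hj hjmin
  have hbr : ∀ (a b : g) (n : ℤ), ρ (elA ⁅a, b⁆ n) = 0 := by
    intro a b n
    ext w
    obtain ⟨N, hN⟩ := hres ⁅a, b⁆ w
    have key : ∀ k : ℕ, ∀ n : ℤ, N - k ≤ n → ρ (elA ⁅a, b⁆ n) w = 0 := by
      intro k
      induction k with
      | zero => intro n hn; exact (hN n (by simpa using hn)).1
      | succ k ih =>
        intro n hn
        by_cases hn' : N - k ≤ n
        · exact ih n hn'
        have hs := hkey a b 0 (n + 1 - j0)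
        rw [hℓ] at hs
        have hs2 := congrArg (fun f : Module.End ℂ W => f w) hs
        simp only [mul_zero, zero_smul, LinearMap.sum_apply, LinearMap.smul_apply,
          LinearMap.zero_apply] at hs2
        rw [Finset.sum_eq_single j0] at hs2
        · rw [show 0 + (n + 1 - (j0 : ℤ)) - 1 + j0 = n by ring] at hs2
          have : P.coeff j0 * (j0 : ℂ) ≠ 0 := mul_ne_zero hj.2 (by exact_mod_cast hj.1)
          exact (smul_eq_zero.mp hs2).resolve_left this
        · intro i _ hi
          rcases lt_or_gt_of_ne hi with h | h
          · rw [hjmin i h, zero_smul]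
          · rw [ih _ (by push_cast at hn; omega), smul_zero]
        · intro h
          exact absurd (Polynomial.mem_support_iff.mpr hj.2) h
    exact key (N - n).toNat n (by omega)
  have hAz : ∀ (c : g) (n : ℤ), ρ (elA c n) = 0 := by
    intro c n
    have hc : c ∈ Submodule.span ℂ {x : g | ∃ a b : g, ⁅a, b⁆ = x} := by rw [hperf]; trivial
    induction hc using Submodule.span_induction with
    | mem x hx => obtain ⟨a, b, rfl⟩ := hx; exact hbr a b n
    | zero => rw [show elA (0 : g) n = 0 by simp [elA], map_zero]
    | add x y _ _ hx hy =>
      rw [show elA (x + y) n = elA x n + elA y n by simp [elA, ← Finsupp.single_add], map_add,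
        hx, hy, add_zero]
    | smul r x _ hx =>
      rw [show elA (r • x) n = r • elA x n by simp [elA], map_smul, hx, smul_zero]
  have hBz : ∀ (c : g) (n : ℤ), ρ (elB c n) = 0 := by
    intro c n
    have hc : c ∈ Submodule.span ℂ {x : g | ∃ a b : g, ⁅a, b⁆ = x} := by rw [hperf]; trivial
    induction hc using Submodule.span_induction with
    | mem x hx =>
      obtain ⟨a, b, rfl⟩ := hx
      have := hL (elA a 0) (elB b n)
      rw [hab, hAz, zero_mul, mul_zero, sub_zero, zero_add] at this
      exact this
    | zero => rw [show elB (0 : g) n = 0 by simp [elB], map_zero]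
    | add x y _ _ hx hy =>
      rw [show elB (x + y) n = elB x n + elB y n by simp [elB, ← Finsupp.single_add], map_add,
        hx, hy, add_zero]
    | smul r x _ hx =>
      rw [show elB (r • x) n = r • elB x n by simp [elB], map_smul, hx, smul_zero]
  constructor
  · have htop := hgen (Submodule.span ℂ {w₀})
      (by intro a n w _; rw [hAz, hBz]; simp) (Submodule.mem_span_singleton_self w₀)
    rw [← finrank_top, ← htop]
    exact finrank_span_singleton hw0
  · have hfin : ∀ f : ℤ →₀ (g × g), ρ (f, 0) = 0 := by
      intro f
      induction f using Finsupp.induction_linear with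
      | zero => exact map_zero ρ
      | add f h hf hh =>
        rw [show ((f + h, 0) : HpSp g) = (f, 0) + (h, 0) by simp, map_add, hf, hh, add_zero]
      | single n x =>
        rw [show ((Finsupp.single n x, 0) : HpSp g) = elA x.1 n + elB x.2 n by
          simp [elA, elB, ← Finsupp.single_add], map_add, hAz, hBz, add_zero]
    rintro ⟨f, c⟩
    rw [show ((f, c) : HpSp g) = (f, 0) + c • elK g by simp [elK], map_add, map_smul, hfin,
      hlevel, hℓ, zero_smul, smul_zero, add_zero]


end
end

section
/- Let W be a nonzero ℂ-vector space, and let a(n), b(n) ∈ End_ℂ(W) for n ∈ ℤ be operators such that for each w ∈ W one has a(n)w = 0 and b(n)w = 0 for all sufficiently large n. Suppose (A_n)_{n∈ℤ} is a family of complex numbers such that [a(1), b(m)] − [a(0), b(m+1)] = A_{−m−1}·id_W for every m ∈ ℤ (this is the coefficient form of the identity Res_z (z−w)[a(z),b(w)] = A(w)·id_W, where a(z) = Σ a(n)z^{−n−1}, b(w) = Σ b(n)w^{−n−1}, A(w) = Σ A_n wⁿ). Then A_n = 0 for all sufficiently negative n; that is, A(w) ∈ ℂ((w)). -/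
/-!
Statement 9 (key step of Lemma 3.3): if `a(n), b(n)` are lower-truncated families of
operators on a nonzero ℂ-vector space `W` and `A : ℤ → ℂ` satisfies
`[a(1), b(m)] − [a(0), b(m+1)] = A_{−m−1}·id` for all `m`, then `A_n = 0` for all
sufficiently negative `n`, i.e. `A(w) ∈ ℂ((w))`.
-/

theorem statement9 {W : Type} [AddCommGroup W] [Module ℂ W]
    -- `W` is nonzero:
    (hW : ∃ w : W, w ≠ 0)
    (a b : ℤ → W →ₗ[ℂ] W)
    -- lower truncation: `a(n)w = 0` and `b(n)w = 0` for `n` sufficiently large: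
    (ha : ∀ w : W, ∃ N : ℤ, ∀ n : ℤ, N ≤ n → a n w = 0)
    (hb : ∀ w : W, ∃ N : ℤ, ∀ n : ℤ, N ≤ n → b n w = 0)
    (A : ℤ → ℂ)
    -- `[a(1), b(m)] − [a(0), b(m+1)] = A_{−m−1}·id_W` for every `m ∈ ℤ`:
    (hrel : ∀ m : ℤ,
      (a 1 ∘ₗ b m - b m ∘ₗ a 1) - (a 0 ∘ₗ b (m + 1) - b (m + 1) ∘ₗ a 0)
        = A (-m - 1) • LinearMap.id) :
    -- `A_n = 0` for all sufficiently negative `n`: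
    ∃ N : ℤ, ∀ n : ℤ, n < N → A n = 0 := by
  obtain ⟨w, hw⟩ := hW
  obtain ⟨N1, h1⟩ := hb w
  obtain ⟨N2, h2⟩ := hb (a 1 w)
  obtain ⟨N3, h3⟩ := hb (a 0 w)
  refine ⟨-(max N1 (max N2 N3)), fun n hn => ?_⟩
  have h := LinearMap.congr_fun (hrel (-n - 1)) w
  have e : -(-n - 1) - 1 = n := by ring
  rw [e] at h
  simp only [LinearMap.sub_apply, LinearMap.comp_apply, LinearMap.smul_apply,
    LinearMap.id_apply] at h
  rw [h1 (-n - 1) (by omega), h2 (-n - 1) (by omega), h1 (-n - 1 + 1) (by omega),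
    h3 (-n - 1 + 1) (by omega)] at h
  simp only [map_zero, sub_zero] at h
  exact (smul_eq_zero.mp h.symm).resolve_right hw
end

section
/- Let β ∈ ℂ, let p(x) = x³ − 2βx² + x, assume g ≠ 0, and let W be a restricted ĝ_p-module of level ℓ with ℓ ≠ 0. For a ∈ g set a(x) = Σ_{n∈ℤ} a(n)x^{−n−1} and a¹(x) = Σ_{n∈ℤ} a¹(n)x^{−n−1}, elements of E(W). Let V_W be the smallest ℂ-subspace of E(W) containing the identity operator 1_W and all the series a(x), a¹(x) for a ∈ g, and closed under all the products (·)_n(·) for n ∈ ℤ. Then V_W is a ℂ[x]-submodule of E(W); that is, x·ψ(x) ∈ V_W for every ψ(x) ∈ V_W. -/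
/-!
Statement 10 (Lemma 3.8): for the elliptic polynomial `p(x) = x³ − 2βx² + x`, `g ≠ 0`,
and a restricted `ĝ_p`-module `W` of level `ℓ ≠ 0`, the vertex algebra `V_W ⊆ E(W)`
generated by `1_W` and the series `a(x), a¹(x)` (`a ∈ g`) under the products
`(·)_n(·)` is a `ℂ[x]`-submodule of `E(W)`: it is closed under multiplication by `x`.

Elements of `E(W) = Hom(W, W((x)))` are represented by their families of components:
`a(x) = Σ aₙ x^{−n−1}` is the family `n ↦ aₙ ∈ End_ℂ(W)` which is lower-truncated on
each vector.  The product `a(x)_n b(x)` given by the residue formula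
`Res_{x₁}((x₁−x)ⁿ a(x₁)b(x) − (−x+x₁)ⁿ b(x)a(x₁))` has the component form
`(a(x)_n b(x))_m = Σ_{i≥0} (−1)ⁱ C(n,i) a_{n−i} b_{m+i} − Σ_{i≥0} (−1)^{n−i} C(n,i) b_{m+n−i} a_i`.
Multiplication by `x` is the index shift `(x·ψ)_m = ψ_{m+1}`.
-/

noncomputable section

/-- The generalized binomial coefficient `C(n,i) = n(n−1)⋯(n−i+1)/i!` for `n ∈ ℤ`. -/
def cchoose (n : ℤ) (i : ℕ) : ℂ :=
  (∏ j ∈ Finset.range i, ((n : ℂ) - (j : ℂ))) / (Nat.factorial i : ℂ)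

/-- `E(W) = Hom(W, W((x)))`: the space of series `Σ aₙ x^{−n−1}` with coefficients in
`End_ℂ(W)`, lower-truncated on each vector, realized as a submodule of `ℤ → End_ℂ(W)`. -/
def Etrunc (W : Type) [AddCommGroup W] [Module ℂ W] : Submodule ℂ (ℤ → W →ₗ[ℂ] W) where
  carrier := {c | ∀ w : W, ∃ N : ℤ, ∀ n : ℤ, N ≤ n → c n w = 0}
  add_mem' := by
    intro x y hx hy w
    obtain ⟨N1, h1⟩ := hx w
    obtain ⟨N2, h2⟩ := hy w
    refine ⟨max N1 N2, fun n hn => ?_⟩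
    have e1 := h1 n (le_trans (le_max_left _ _) hn)
    have e2 := h2 n (le_trans (le_max_right _ _) hn)
    simp [e1, e2]
  zero_mem' := fun w => ⟨0, fun n _ => rfl⟩
  smul_mem' := by
    intro c x hx w
    obtain ⟨N, h⟩ := hx w
    exact ⟨N, fun n hn => by simp [h n hn]⟩

variable {W : Type} [AddCommGroup W] [Module ℂ W]

/-- The component form of the product `a(x)_n b(x)` of two elements of `E(W)`,
given by the residue formula. -/
def eprodFun (n : ℤ) (F G : ℤ → W →ₗ[ℂ] W) : ℤ → W → W := fun m w =>
  (∑ᶠ i : ℕ, ((-1 : ℂ) ^ i * cchoose n i) • F (n - (i : ℤ)) (G (m + (i : ℤ)) w))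
    - ∑ᶠ i : ℕ, ((-1 : ℂ) ^ (n - (i : ℤ)) * cchoose n i) • G (m + n - (i : ℤ)) (F (i : ℤ) w)

private lemma finite_of_bound {M : Type} [AddCommGroup M] (φ : ℕ → M) (N : ℤ)
    (h : ∀ i : ℕ, N ≤ (i : ℤ) → φ i = 0) : (Function.support φ).Finite := by
  apply Set.Finite.subset (Set.finite_Iio N.toNat)
  intro i hi
  simp only [Set.mem_Iio]
  by_contra hlt
  push_neg at hlt
  exact hi (h i (by omega))

/-- The product `a(x)_n b(x)` as an operation on `E(W)`. -/
def emul (n : ℤ) (F G : Etrunc W) : Etrunc W :=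
  ⟨fun m =>
    { toFun := fun w => eprodFun n (F : ℤ → W →ₗ[ℂ] W) (G : ℤ → W →ₗ[ℂ] W) m w
      map_add' := by
        intro w w'
        obtain ⟨N1, h1⟩ := G.2 w
        obtain ⟨N1', h1'⟩ := G.2 w'
        obtain ⟨N2, h2⟩ := F.2 w
        obtain ⟨N2', h2'⟩ := F.2 w'
        simp only [eprodFun, map_add, smul_add]
        rw [finsum_add_distrib
            (by exact finite_of_bound _ (N1 - m) fun i hi => by
                  rw [h1 (m + i) (by omega), map_zero, smul_zero])
            (by exact finite_of_bound _ (N1' - m) fun i hi => by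
                  rw [h1' (m + i) (by omega), map_zero, smul_zero]),
          finsum_add_distrib
            (by exact finite_of_bound _ N2 fun i hi => by
                  rw [h2 i (by omega), map_zero, smul_zero])
            (by exact finite_of_bound _ N2' fun i hi => by
                  rw [h2' i (by omega), map_zero, smul_zero])]
        abel
      map_smul' := by
        intro c w
        simp only [eprodFun, map_smul, RingHom.id_apply, smul_sub]
        rw [smul_finsum, smul_finsum]
        simp_rw [smul_comm c]
      }
    , by
      intro w
      obtain ⟨N1, h1⟩ := G.2 w
      obtain ⟨N2, h2⟩ := F.2 w
      classical
      let K : ℕ → ℤ := fun i => Classical.choose (G.2 ((F : ℤ → W →ₗ[ℂ] W) i w))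
      have hK : ∀ (i : ℕ) (k : ℤ), K i ≤ k →
          (G : ℤ → W →ₗ[ℂ] W) k ((F : ℤ → W →ₗ[ℂ] W) i w) = 0 :=
        fun i => Classical.choose_spec (G.2 ((F : ℤ → W →ₗ[ℂ] W) i w))
      refine ⟨max N1 (((Finset.range N2.toNat).sup fun i => (K i + i - n).toNat : ℕ) : ℤ),
        fun m hm => ?_⟩
      have hm1 : N1 ≤ m := le_trans (le_max_left _ _) hm
      have hm2 : (((Finset.range N2.toNat).sup fun i => (K i + i - n).toNat : ℕ) : ℤ) ≤ m :=
        le_trans (le_max_right _ _) hm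
      have hz2 : ∀ i : ℕ,
          ((-1 : ℂ) ^ (n - (i : ℤ)) * cchoose n i) •
            (G : ℤ → W →ₗ[ℂ] W) (m + n - (i : ℤ)) ((F : ℤ → W →ₗ[ℂ] W) (i : ℤ) w) = 0 := by
        intro i
        rcases le_or_gt N2 (i : ℤ) with hi | hi
        · rw [h2 i hi, map_zero, smul_zero]
        · have him : i ∈ Finset.range N2.toNat := Finset.mem_range.mpr (by omega)
          have hle : (K i + (i : ℤ) - n).toNat ≤
              (Finset.range N2.toNat).sup fun j => (K j + (j : ℤ) - n).toNat :=
            Finset.le_sup (f := fun j => (K j + (j : ℤ) - n).toNat) him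
          have hKi : (((K i + (i : ℤ) - n).toNat : ℕ) : ℤ) ≤ m :=
            le_trans (Nat.cast_le.mpr hle) hm2
          rw [hK i (m + n - i) (by omega), smul_zero]
      simp only [LinearMap.coe_mk, AddHom.coe_mk, eprodFun]
      rw [finsum_eq_zero_of_forall_eq_zero fun i => by
          rw [h1 (m + i) (by omega), map_zero, smul_zero],
        finsum_eq_zero_of_forall_eq_zero hz2, sub_zero]⟩



noncomputable section

variable {g : Type} [LieRing g] [LieAlgebra ℂ g]

lemma cchoose_zero' (n : ℤ) : cchoose n 0 = 1 := by simp [cchoose]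

lemma cchoose_one' (n : ℤ) : cchoose n 1 = n := by simp [cchoose]

lemma cchoose_one_ge (i : ℕ) (hi : 2 ≤ i) : cchoose 1 i = 0 := by
  unfold cchoose
  rw [Finset.prod_eq_zero (i := 1) (Finset.mem_range.mpr (by omega)) (by simp)]
  simp

lemma finsum_two {M : Type} [AddCommGroup M] (f : ℕ → M) (h : ∀ i, 2 ≤ i → f i = 0) :
    ∑ᶠ i, f i = f 0 + f 1 := by
  rw [finsum_eq_sum_of_support_subset (s := Finset.range 2)]
  · simp [Finset.sum_range_succ]
  · intro i hi
    simp only [Finset.coe_range, Set.mem_Iio]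
    by_contra hlt
    exact hi (h i (by omega))

lemma emul_apply' {W : Type} [AddCommGroup W] [Module ℂ W] (n : ℤ) (F G : Etrunc W) (m : ℤ)
    (w : W) : (emul n F G : ℤ → W →ₗ[ℂ] W) m w =
      eprodFun n (F : ℤ → W →ₗ[ℂ] W) (G : ℤ → W →ₗ[ℂ] W) m w := rfl

lemma emul_one' {W : Type} [AddCommGroup W] [Module ℂ W] (F G : Etrunc W) (m : ℤ)
    (w : W) : (emul 1 F G : ℤ → W →ₗ[ℂ] W) m w =
      (F.1 1 (G.1 m w) - G.1 m (F.1 1 w)) - (F.1 0 (G.1 (m + 1) w) - G.1 (m + 1) (F.1 0 w)) := by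
  rw [emul_apply', eprodFun, finsum_two, finsum_two]
  · simp [cchoose_zero', cchoose_one']
    abel
  · intro i hi; rw [cchoose_one_ge i hi]; simp
  · intro i hi; rw [cchoose_one_ge i hi]; simp

lemma emul_neg3' {W : Type} [AddCommGroup W] [Module ℂ W] (F G : Etrunc W)
    (h1 : ∀ k : ℤ, 0 ≤ k → F.1 k = 0) (h2 : ∀ k : ℤ, k ≤ -5 → F.1 k = 0) (m : ℤ)
    (w : W) : (emul (-3) F G : ℤ → W →ₗ[ℂ] W) m w =
      F.1 (-3) (G.1 m w) + (3 : ℂ) • F.1 (-4) (G.1 (m + 1) w) := by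
  rw [emul_apply', eprodFun, finsum_two, finsum_eq_zero_of_forall_eq_zero]
  · simp [cchoose_zero', cchoose_one']
  · intro i; rw [h1 i (by omega)]; simp
  · intro i hi; rw [h2 _ (by omega)]; simp

lemma emul_X' {W : Type} [AddCommGroup W] [Module ℂ W] (F G : Etrunc W)
    (h : ∀ k : ℤ, F.1 k = if k = -2 then LinearMap.id else 0) (m : ℤ)
    (w : W) : (emul (-1) F G : ℤ → W →ₗ[ℂ] W) m w = G.1 (m + 1) w := by
  rw [emul_apply', eprodFun, finsum_two, finsum_eq_zero_of_forall_eq_zero]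
  · simp [cchoose_zero', cchoose_one', h]
  · intro i; rw [h, if_neg (by omega)]; simp
  · intro i hi; rw [h, if_neg (by omega)]; simp

theorem statement10
    (Φ : g →ₗ[ℂ] g →ₗ[ℂ] ℂ)
    (hsymm : ∀ a b : g, Φ a b = Φ b a)
    (hinv : ∀ a b c : g, Φ ⁅a, b⁆ c = Φ a ⁅b, c⁆)
    (hnondeg : ∀ a : g, (∀ b : g, Φ a b = 0) → a = 0)
    -- `g ≠ 0`:
    (hg : Nontrivial g)
    -- the elliptic polynomial `p(x) = x³ − 2βx² + x`:
    (β : ℂ) (P : Polynomial ℂ)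
    (hP : P = Polynomial.X ^ 3 - Polynomial.C (2 * β) * Polynomial.X ^ 2 + Polynomial.X)
    -- the ℂ-bilinear bracket of `ĝ_p`, specified on spanning elements:
    (B : HpSp g →ₗ[ℂ] HpSp g →ₗ[ℂ] HpSp g)
    (hkl : ∀ x : HpSp g, B (elK g) x = 0)
    (hkr : ∀ x : HpSp g, B x (elK g) = 0)
    (haa : ∀ (a b : g) (m n : ℤ),
      B (elA a m) (elA b n)
        = elA ⁅a, b⁆ (m + n)
          + ((m : ℂ) * Φ a b * (if m + n = 0 then 1 else 0)) • elK g)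
    (hab : ∀ (a b : g) (m n : ℤ), B (elA a m) (elB b n) = elB ⁅a, b⁆ (m + n))
    (hba : ∀ (a b : g) (m n : ℤ), B (elB a m) (elA b n) = elB ⁅a, b⁆ (m + n))
    (hbb : ∀ (a b : g) (m n : ℤ),
      B (elB a m) (elB b n)
        = P.sum (fun j c => c • elA ⁅a, b⁆ (m + n + (j : ℤ)))
          + ((1 / 2 : ℂ) * ((m : ℂ) - (n : ℂ)) * Φ a b * coeffZ P (-m - n)) • elK g)
    -- a restricted `ĝ_p`-module `W` of level `ℓ ≠ 0`:
    {W : Type} [AddCommGroup W] [Module ℂ W]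
    (ρ : HpSp g →ₗ[ℂ] W →ₗ[ℂ] W)
    (hLie : ∀ x y : HpSp g, ρ (B x y) = ρ x ∘ₗ ρ y - ρ y ∘ₗ ρ x)
    (ℓ : ℂ) (hl : ℓ ≠ 0)
    (hlevel : ρ (elK g) = ℓ • LinearMap.id)
    -- the series `a(x), a¹(x) ∈ E(W)` for `a ∈ g` (their existence in `E(W)` encodes
    -- that `W` is restricted), and the identity series `1_W = 1_W x⁰`:
    (aS bS : g → Etrunc W)
    (haS : ∀ (a : g) (n : ℤ), (aS a : ℤ → W →ₗ[ℂ] W) n = ρ (elA a n))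
    (hbS : ∀ (a : g) (n : ℤ), (bS a : ℤ → W →ₗ[ℂ] W) n = ρ (elB a n))
    (idE : Etrunc W)
    (hidE : (idE : ℤ → W →ₗ[ℂ] W) = fun n => if n = -1 then LinearMap.id else 0) :
    -- `V_W`, the smallest subspace of `E(W)` containing `1_W` and all `a(x), a¹(x)`
    -- and closed under all the products, is closed under multiplication by `x`:
    ∀ ψ ∈ sInf {V : Submodule ℂ (Etrunc W) |
        idE ∈ V ∧ (∀ a : g, aS a ∈ V ∧ bS a ∈ V) ∧
        ∀ u ∈ V, ∀ v ∈ V, ∀ n : ℤ, emul n u v ∈ V},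
      ∀ χ : Etrunc W,
        ((χ : ℤ → W →ₗ[ℂ] W) = fun m => (ψ : ℤ → W →ₗ[ℂ] W) (m + 1)) →
        χ ∈ sInf {V : Submodule ℂ (Etrunc W) |
          idE ∈ V ∧ (∀ a : g, aS a ∈ V ∧ bS a ∈ V) ∧
          ∀ u ∈ V, ∀ v ∈ V, ∀ n : ℤ, emul n u v ∈ V} := by
  intro ψ hψ χ hχ
  rw [Submodule.mem_sInf] at hψ ⊢
  intro V hV
  have hψV := hψ V hV
  obtain ⟨hid, hab', hmul⟩ := hV
  obtain ⟨a, ha⟩ := exists_ne (0 : g)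
  obtain ⟨b, hb⟩ : ∃ b, Φ a b ≠ 0 := by
    by_contra hcon
    push Not at hcon
    exact ha (hnondeg a hcon)
  set F : Etrunc W := emul 1 (bS a) (bS b) with hF
  have hFV : F ∈ V := hmul _ (hab' a).2 _ (hab' b).2 1
  have hcomm : ∀ (m n : ℤ) (w : W), (bS a).1 m ((bS b).1 n w) - (bS b).1 n ((bS a).1 m w)
      = ρ (P.sum (fun j c => c • elA ⁅a, b⁆ (m + n + (j : ℤ)))) w
        + ((1 / 2 : ℂ) * ((m : ℂ) - (n : ℂ)) * Φ a b * coeffZ P (-m - n) * ℓ) • w := by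
    intro m n w
    have h := congrArg (fun f : W →ₗ[ℂ] W => f w) (hLie (elB a m) (elB b n))
    simp only [hbb, map_add, map_smul, hlevel, LinearMap.add_apply, LinearMap.sub_apply,
      LinearMap.smul_apply, LinearMap.comp_apply, LinearMap.id_apply, smul_smul] at h
    rw [hbS, hbS]
    exact h.symm
  have hFc : ∀ (m : ℤ), F.1 m = (Φ a b * coeffZ P (-m - 1) * ℓ) • LinearMap.id := by
    intro m
    ext w
    rw [hF, emul_one', hcomm, hcomm]
    rw [show (0 : ℤ) + (m + 1) = 1 + m by ring, show -(0 : ℤ) - (m + 1) = -m - 1 by ring,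
      show -(1 : ℤ) - m = -m - 1 by ring, add_sub_add_left_eq_sub, ← sub_smul]
    simp only [LinearMap.smul_apply, LinearMap.id_apply]
    congr 1
    push_cast
    ring
  have cc : ∀ n, P.coeff n = (if n = 3 then 1 else 0) - 2 * β * (if n = 2 then 1 else 0)
      + (if 1 = n then 1 else 0) := by
    intro n
    rw [hP, Polynomial.coeff_add, Polynomial.coeff_sub, Polynomial.coeff_C_mul,
      Polynomial.coeff_X_pow, Polynomial.coeff_X_pow, Polynomial.coeff_X]
  have c3 : P.coeff 3 = 1 := by simp [cc]
  have c4 : ∀ n, 4 ≤ n → P.coeff n = 0 := by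
    intro n hn
    rw [cc, if_neg (by omega), if_neg (by omega), if_neg (by omega)]
    ring
  have k1 : ∀ k : ℤ, 0 ≤ k → F.1 k = 0 := by
    intro k hk
    rw [hFc, coeffZ, if_neg (by omega)]
    simp
  have k2 : ∀ k : ℤ, k ≤ -5 → F.1 k = 0 := by
    intro k hk
    rw [hFc, coeffZ, if_pos (by omega), c4 _ (by omega)]
    simp
  set c : ℂ := Φ a b * ℓ with hc
  have hc0 : c ≠ 0 := mul_ne_zero hb hl
  let X : Etrunc W := (1 / (3 * c)) • (emul (-3) F idE - (c * P.coeff 2) • idE)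
  have hXV : X ∈ V :=
    V.smul_mem _ (V.sub_mem (hmul _ hFV _ hid _) (V.smul_mem _ hid))
  have hX : ∀ k : ℤ, X.1 k = if k = -2 then LinearMap.id else 0 := by
    intro k
    ext w
    have e : X.1 k w = (1 / (3 * c)) • ((emul (-3) F idE).1 k w - (c * P.coeff 2) • idE.1 k w) :=
      rfl
    rw [e, emul_neg3' F idE k1 k2, hFc, hFc, hidE]
    have z2 : coeffZ P (-(-3) - 1) = P.coeff 2 := by simp [coeffZ]
    have z3 : coeffZ P (-(-4) - 1) = 1 := by
      rw [← c3]; simp [coeffZ]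
    rw [z2, z3]
    simp only [LinearMap.smul_apply, LinearMap.id_apply]
    rw [show Φ a b * P.coeff 2 * ℓ = c * P.coeff 2 by rw [hc]; ring, add_sub_cancel_left,
      smul_smul, smul_smul, show 1 / (3 * c) * 3 * (Φ a b * 1 * ℓ) = 1 by
        rw [show Φ a b * 1 * ℓ = c by rw [hc]; ring]; field_simp, one_smul]
    by_cases hk : k = -2
    · subst hk; simp
    · rw [if_neg hk, if_neg (by omega)]
  have : χ = emul (-1) X ψ := by
    apply Subtype.ext
    funext m
    ext w
    rw [emul_X' X ψ hX, hχ]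
  rw [this]
  exact hmul _ hXV _ hψV _

end
end
end
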